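/- H² regularity for the regularized nonlinear filter equation: fix α>0, assume β ≤ A ≤ 1 (0<β<1), A ∈ C^{1,1}(ℝ³), and φ ∈ H¹(𝕋³). Let u ∈ L^∞([0,T],L²_s(𝕋³)) and let u_α ∈ L^∞([0,T],H¹(𝕋³)) be the weak solution of −α² div(A(φ∗u)(∇⊗u_α)ᵀ) + u_α = u, div(u_α)=0. Set L₂ = α² ‖∇A‖_{L^∞} ‖φ‖_{H¹}. Then u_α ∈ L^∞([0,T],H²(𝕋³)) and for all 0≤t≤T, ‖u_α(t,·)‖_{H²} ≤ K₂ (‖u(t,·)‖_{L²} + 1) ‖u(t,·)‖_{L²}, with K₂ ≃ max(K₀^{3/2} L₂, K₀) and K₀ ≃ 1/min(α²β,1). -/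

import Mathlib

/-!
Common framework for the Navier–Stokes-alpha model with a nonlinear filter equation,
on the periodic torus `𝕋³ = [0,L]³`.  Function spaces are encoded through Fourier
coefficients on the frequency lattice `(2π/L)ℤ³`.
-/

open MeasureTheory Real Filter Topology

noncomputable section

namespace NSAlpha

/-- spatial points -/
abbrev Pt := Fin 3 → ℝ
/-- values of vector fields -/
abbrev Vec := Fin 3 → ℝ
/-- the frequency lattice indices -/
abbrev Lat := Fin 3 → ℤ

/-- fundamental domain `[0,L]³` of the torus of period `L` -/
def box (L : ℝ) : Set Pt := Set.univ.pi fun _ => Set.Icc (0 : ℝ) L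

/-- `L`-periodicity of a vector field -/
def SpacePeriodic (L : ℝ) (g : Pt → Vec) : Prop :=
  ∀ (x : Pt) (n : Lat), g (fun i => x i + L * (n i : ℝ)) = g x

/-- `L`-periodicity of a scalar function -/
def SpacePeriodicS (L : ℝ) (g : Pt → ℝ) : Prop :=
  ∀ (x : Pt) (n : Lat), g (fun i => x i + L * (n i : ℝ)) = g x

/-- the frequency `2πk/L` -/
def freq (L : ℝ) (k : Lat) (i : Fin 3) : ℝ := (2 * π / L) * (k i : ℝ)

/-- `|2πk/L|²` -/
def freqNormSq (L : ℝ) (k : Lat) : ℝ := ∑ i, freq L k i ^ 2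

/-- the character `e^{-i k·x}` -/
def em (L : ℝ) (k : Lat) (x : Pt) : ℂ :=
  Complex.exp (-Complex.I * ((∑ i, freq L k i * x i : ℝ) : ℂ))

/-- `k`-th Fourier coefficient of a scalar function on the torus -/
def fcS (L : ℝ) (g : Pt → ℝ) (k : Lat) : ℂ :=
  (L ^ 3)⁻¹ • ∫ x in box L, em L k x * (g x : ℂ)

/-- `k`-th Fourier coefficient of a vector field (componentwise) -/
def fc (L : ℝ) (g : Pt → Vec) (k : Lat) (i : Fin 3) : ℂ :=
  fcS L (fun x => g x i) k

/-- squared norm of a complex coefficient vector -/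
def cnormSq (c : Fin 3 → ℂ) : ℝ := ∑ i, Complex.normSq (c i)

/-- squared homogeneous Sobolev norm `‖g‖²_{Ḣ^s}` (via Fourier series) -/
def homSobSq (L s : ℝ) (g : Pt → Vec) : ℝ :=
  L ^ 3 * ∑' k : Lat, freqNormSq L k ^ s * cnormSq (fc L g k)

/-- summability of the `Ḣ^s` Fourier series -/
def homSummable (L s : ℝ) (g : Pt → Vec) : Prop :=
  Summable fun k : Lat => freqNormSq L k ^ s * cnormSq (fc L g k)

/-- squared nonhomogeneous Sobolev norm `‖g‖²_{H^s}` -/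
def sobSq (L s : ℝ) (g : Pt → Vec) : ℝ :=
  L ^ 3 * ∑' k : Lat, (1 + freqNormSq L k) ^ s * cnormSq (fc L g k)

/-- summability of the `H^s` Fourier series -/
def sobSummable (L s : ℝ) (g : Pt → Vec) : Prop :=
  Summable fun k : Lat => (1 + freqNormSq L k) ^ s * cnormSq (fc L g k)

/-- squared homogeneous Sobolev norm of a scalar function -/
def homSobSqS (L s : ℝ) (g : Pt → ℝ) : ℝ :=
  L ^ 3 * ∑' k : Lat, freqNormSq L k ^ s * Complex.normSq (fcS L g k)

/-- zero mean value -/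
def ZeroMean (L : ℝ) (g : Pt → Vec) : Prop := ∀ i, fc L g 0 i = 0

/-- divergence-free condition, in the Fourier (distributional) sense -/
def DivFree (L : ℝ) (g : Pt → Vec) : Prop :=
  ∀ k : Lat, ∑ i, (freq L k i : ℂ) * fc L g k i = 0

/-- membership in `L²_s(𝕋³)` : periodic, integrable, zero-mean, divergence-free,
with square-summable Fourier coefficients -/
def MemL2s (L : ℝ) (g : Pt → Vec) : Prop :=
  SpacePeriodic L g ∧ IntegrableOn g (box L) ∧ ZeroMean L g ∧ DivFree L g ∧
    homSummable L 0 g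

/-- membership in the (zero-mean) Sobolev space `H^s(𝕋³)` -/
def MemHs (L s : ℝ) (g : Pt → Vec) : Prop :=
  SpacePeriodic L g ∧ IntegrableOn g (box L) ∧ ZeroMean L g ∧ sobSummable L s g

/-- periodic convolution `φ ∗ g` on the torus -/
def pconv (L : ℝ) (φ : Pt → ℝ) (g : Pt → Vec) (x : Pt) : Vec :=
  fun i => ∫ y in box L, φ y * g (fun a => x a - y a) i

/-- the Fourier transform of `−α² div(B (∇⊗v)ᵀ) + v`, tested against `e^{-ik·x}eᵢ`
(normalized by `L³`); the derivative of `v` is taken in the weak (Fourier) sense. -/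
def filterLHS (L α : ℝ) (B : Pt → ℝ) (v : Pt → Vec) (k : Lat) (i : Fin 3) : ℂ :=
  ((α ^ 2 : ℝ) : ℂ) *
      ∑' m : Lat, ((∑ a, freq L k a * freq L m a : ℝ) : ℂ) *
        fcS L B (fun a => k a - m a) * fc L v m i
    + fc L v k i

/-- weak formulation of the nonlinear filter equation `−α² div(B (∇⊗v)ᵀ) + v = g` -/
def FilterEq (L α : ℝ) (B : Pt → ℝ) (v g : Pt → Vec) : Prop :=
  ∀ (k : Lat) (i : Fin 3), filterLHS L α B v k i = fc L g k i

/-- Fourier coefficients of the transport term `(v·∇)g = div(g ⊗ v)` (when `div v = 0`) -/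
def transportCoef (L : ℝ) (g v : Pt → Vec) (k : Lat) (i : Fin 3) : ℂ :=
  Complex.I * ∑ j, ((freq L k j : ℝ) : ℂ) * fcS L (fun x => g x i * v x j) k

/-- the Leray projector on Fourier coefficients -/
def leray (L : ℝ) (k : Lat) (c : Fin 3 → ℂ) (i : Fin 3) : ℂ :=
  if k = 0 then c i
  else c i - ((∑ j, c j * ((freq L k j : ℝ) : ℂ)) / ((freqNormSq L k : ℝ) : ℂ)) *
    ((freq L k i : ℝ) : ℂ)

/-- squared `Ḣ⁻¹` norm of a family of Fourier coefficients -/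
def hNegSobSq (L : ℝ) (c : Lat → Fin 3 → ℂ) : ℝ :=
  L ^ 3 * ∑' k : Lat, freqNormSq L k ^ (-(1 : ℝ)) * cnormSq (c k)

/-- an external force in `L²_loc([0,∞), Ḣ⁻¹(𝕋³))`, divergence-free and zero-mean,
represented through its (time-dependent) Fourier coefficients -/
structure ForceData (L : ℝ) where
  coef : ℝ → Lat → Fin 3 → ℂ
  reality : ∀ t k i, coef t (fun j => -k j) i = starRingEnd ℂ (coef t k i)
  zeroMean : ∀ t i, coef t 0 i = 0
  divFree : ∀ t k, ∑ i, (freq L k i : ℂ) * coef t k i = 0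
  hsummable : ∀ t, Summable fun k : Lat => freqNormSq L k ^ (-(1 : ℝ)) * cnormSq (coef t k)
  locL2 : ∀ T : ℝ, 0 < T → IntegrableOn (fun t => hNegSobSq L (coef t)) (Set.Icc 0 T)

/-- a stationary (time-independent) force in `Ḣ⁻¹(𝕋³) ∩ L²_s(𝕋³)` -/
structure StatForce (L : ℝ) where
  coef : Lat → Fin 3 → ℂ
  reality : ∀ k i, coef (fun j => -k j) i = starRingEnd ℂ (coef k i)
  zeroMean : ∀ i, coef 0 i = 0
  divFree : ∀ k, ∑ i, (freq L k i : ℂ) * coef k i = 0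
  memHneg : Summable fun k : Lat => freqNormSq L k ^ (-(1 : ℝ)) * cnormSq (coef k)
  memL2 : Summable fun k : Lat => cnormSq (coef k)

/-- the duality pairing `⟨f, g⟩_{Ḣ⁻¹×Ḣ¹}` -/
def pairing (L : ℝ) (c : Lat → Fin 3 → ℂ) (g : Pt → Vec) : ℝ :=
  L ^ 3 * (∑' k : Lat, ∑ i, c k i * starRingEnd ℂ (fc L g k i)).re

/-- the `L²` inner product of two fields (by Parseval) -/
def l2Pair (L : ℝ) (g h : Pt → Vec) : ℝ :=
  L ^ 3 * (∑' k : Lat, ∑ i, fc L g k i * starRingEnd ℂ (fc L h k i)).re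

/-- weak formulation of the momentum equation with pressure,
`∂ₜu − νΔu + (v·∇)u + ∇P = f`, `u(0,·)=u₀`, tested in Fourier in space
and against smooth compactly supported functions of time -/
def WeakMomentum (L ν : ℝ) (fcoef : ℝ → Lat → Fin 3 → ℂ) (u v : ℝ → Pt → Vec)
    (P : ℝ → Pt → ℝ) (u₀ : Pt → Vec) : Prop :=
  ∀ (k : Lat) (i : Fin 3) (θ : ℝ → ℝ), ContDiff ℝ (⊤ : ℕ∞) θ → HasCompactSupport θ →
    (∫ t in Set.Ioi (0 : ℝ),
        ((-(deriv θ t) : ℝ) : ℂ) * fc L (u t) k i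
          + ((θ t : ℝ) : ℂ) * (((ν * freqNormSq L k : ℝ) : ℂ) * fc L (u t) k i
              + transportCoef L (u t) (v t) k i
              + Complex.I * ((freq L k i : ℝ) : ℂ) * fcS L (P t) k
              - fcoef t k i))
      = ((θ 0 : ℝ) : ℂ) * fc L u₀ k i

/-- weak formulation of the Leray-projected momentum equation,
`∂ₜu − νΔu + ℙ((v·∇)u) = f`, `u(0,·)=u₀` -/
def WeakMomentumProj (L ν : ℝ) (fcoef : ℝ → Lat → Fin 3 → ℂ) (u v : ℝ → Pt → Vec)
    (u₀ : Pt → Vec) : Prop :=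
  ∀ (k : Lat) (i : Fin 3) (θ : ℝ → ℝ), ContDiff ℝ (⊤ : ℕ∞) θ → HasCompactSupport θ →
    (∫ t in Set.Ioi (0 : ℝ),
        ((-(deriv θ t) : ℝ) : ℂ) * fc L (u t) k i
          + ((θ t : ℝ) : ℂ) * (((ν * freqNormSq L k : ℝ) : ℂ) * fc L (u t) k i
              + leray L k (transportCoef L (u t) (v t) k) i
              - fcoef t k i))
      = ((θ 0 : ℝ) : ℂ) * fc L u₀ k i

/-- weak formulation of the Leray-projected momentum equation on the whole line `ℝ`
(for eternal solutions), with a stationary force -/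
def WeakMomentumProjEternal (L ν : ℝ) (fcoef : Lat → Fin 3 → ℂ) (u v : ℝ → Pt → Vec) :
    Prop :=
  ∀ (k : Lat) (i : Fin 3) (θ : ℝ → ℝ), ContDiff ℝ (⊤ : ℕ∞) θ → HasCompactSupport θ →
    (∫ t : ℝ,
        ((-(deriv θ t) : ℝ) : ℂ) * fc L (u t) k i
          + ((θ t : ℝ) : ℂ) * (((ν * freqNormSq L k : ℝ) : ℂ) * fc L (u t) k i
              + leray L k (transportCoef L (u t) (v t) k) i
              - fcoef k i))
      = 0

/-- the Leray energy inequality -/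
def EnergyIneq (L ν : ℝ) (fcoef : ℝ → Lat → Fin 3 → ℂ) (u : ℝ → Pt → Vec)
    (u₀ : Pt → Vec) : Prop :=
  ∀ t : ℝ, 0 ≤ t →
    homSobSq L 0 (u t) + 2 * ν * ∫ s in Set.Ioc (0 : ℝ) t, homSobSq L 1 (u s)
      ≤ homSobSq L 0 u₀ + 2 * ∫ s in Set.Ioc (0 : ℝ) t, pairing L (fcoef s) (u s)

/-- weak Leray solution of the Navier–Stokes-alpha system with a general
filter coefficient map `Bmap` (the filter coefficient may depend on `u`) -/
structure IsLeraySolGen (L ν α : ℝ) (Bmap : (Pt → Vec) → Pt → ℝ) (u₀ : Pt → Vec)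
    (f : ForceData L) (u uα : ℝ → Pt → Vec) (P : ℝ → Pt → ℝ) : Prop where
  uMem : ∀ t : ℝ, 0 ≤ t → MemL2s L (u t)
  uLocBdd : ∀ T : ℝ, 0 < T → ∃ M : ℝ, ∀ t ∈ Set.Icc (0 : ℝ) T, homSobSq L 0 (u t) ≤ M
  uH1ae : ∀ T : ℝ, 0 < T →
    ∀ᵐ t ∂(volume.restrict (Set.Icc (0 : ℝ) T)), homSummable L 1 (u t)
  uH1int : ∀ T : ℝ, 0 < T → IntegrableOn (fun t => homSobSq L 1 (u t)) (Set.Icc (0 : ℝ) T)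
  uaMem : ∀ t : ℝ, 0 ≤ t → MemHs L 1 (uα t) ∧ DivFree L (uα t)
  uaLocBdd : ∀ T : ℝ, 0 < T → ∃ M : ℝ, ∀ t ∈ Set.Icc (0 : ℝ) T, sobSq L 1 (uα t) ≤ M
  pPeriodic : ∀ t : ℝ, 0 ≤ t → SpacePeriodicS L (P t)
  pL2 : ∀ t : ℝ, 0 ≤ t → IntegrableOn (fun x => P t x ^ 2) (box L)
  pLoc : ∀ T : ℝ, 0 < T →
    IntegrableOn (fun t => ∫ x in box L, P t x ^ 2) (Set.Icc (0 : ℝ) T)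
  momentum : WeakMomentum L ν f.coef u uα P u₀
  filter : ∀ t : ℝ, 0 ≤ t → FilterEq L α (Bmap (u t)) (uα t) (u t)
  energy : EnergyIneq L ν f.coef u u₀

/-- weak Leray solution of the Navier–Stokes-alpha model with the
regularized nonlinear filter `−α² div(A(φ∗u)(∇⊗u_α)ᵀ) + u_α = u` -/
def IsLeraySol (L ν α : ℝ) (A : Vec → ℝ) (φ : Pt → ℝ) (u₀ : Pt → Vec) (f : ForceData L)
    (u uα : ℝ → Pt → Vec) (P : ℝ → Pt → ℝ) : Prop :=
  IsLeraySolGen L ν α (fun g x => A (pconv L φ g x)) u₀ f u uα P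

/-- weak Leray solution of the Leray-projected system with stationary force,
with a general filter coefficient map -/
structure IsLeraySolProjGen (L ν α : ℝ) (Bmap : (Pt → Vec) → Pt → ℝ) (u₀ : Pt → Vec)
    (f : StatForce L) (u uα : ℝ → Pt → Vec) : Prop where
  uMem : ∀ t : ℝ, 0 ≤ t → MemL2s L (u t)
  uLocBdd : ∀ T : ℝ, 0 < T → ∃ M : ℝ, ∀ t ∈ Set.Icc (0 : ℝ) T, homSobSq L 0 (u t) ≤ M
  uH1ae : ∀ T : ℝ, 0 < T →
    ∀ᵐ t ∂(volume.restrict (Set.Icc (0 : ℝ) T)), homSummable L 1 (u t)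
  uH1int : ∀ T : ℝ, 0 < T → IntegrableOn (fun t => homSobSq L 1 (u t)) (Set.Icc (0 : ℝ) T)
  uaMem : ∀ t : ℝ, 0 ≤ t → MemHs L 1 (uα t) ∧ DivFree L (uα t)
  momentum : WeakMomentumProj L ν (fun _ => f.coef) u uα u₀
  filter : ∀ t : ℝ, 0 ≤ t → FilterEq L α (Bmap (u t)) (uα t) (u t)
  energy : EnergyIneq L ν (fun _ => f.coef) u u₀

/-- weak Leray solution of the projected Navier–Stokes-alpha model (regularized filter) -/
def IsLeraySolProj (L ν α : ℝ) (A : Vec → ℝ) (φ : Pt → ℝ) (u₀ : Pt → Vec)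
    (f : StatForce L) (u uα : ℝ → Pt → Vec) : Prop :=
  IsLeraySolProjGen L ν α (fun g x => A (pconv L φ g x)) u₀ f u uα

/-- `S` realizes the solution semi-group of the projected Navier–Stokes-alpha model -/
def IsSolutionSemigroup (L ν α : ℝ) (A : Vec → ℝ) (φ : Pt → ℝ) (f : StatForce L)
    (S : ℝ → (Pt → Vec) → Pt → Vec) : Prop :=
  (∀ g : Pt → Vec, MemL2s L g →
      S 0 g = g ∧ ∃ uα, IsLeraySolProj L ν α A φ g f (fun t => S t g) uα) ∧
    ∀ g : Pt → Vec, MemL2s L g → ∀ s t : ℝ, 0 ≤ s → 0 ≤ t → S (t + s) g = S t (S s g)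

/-- the `L²(𝕋³)` distance between two fields -/
def dL2 (L : ℝ) (g h : Pt → Vec) : ℝ :=
  Real.sqrt (homSobSq L 0 fun x i => g x i - h x i)

/-- bounded subsets of `L²_s(𝕋³)` -/
def IsBoundedL2s (L : ℝ) (B : Set (Pt → Vec)) : Prop :=
  (∀ g ∈ B, MemL2s L g) ∧ ∃ R : ℝ, ∀ g ∈ B, homSobSq L 0 g ≤ R

/-- (sequential) compactness in the strong topology of `L²(𝕋³)` -/
def IsCompactL2 (L : ℝ) (K : Set (Pt → Vec)) : Prop :=
  ∀ seq : ℕ → Pt → Vec, (∀ n, seq n ∈ K) →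
    ∃ g ∈ K, ∃ ψ : ℕ → ℕ, StrictMono ψ ∧
      Tendsto (fun n => dL2 L (seq (ψ n)) g) atTop (nhds 0)

/-- global attractor of the semi-group `S` acting on `L²_s(𝕋³)` : compact,
strictly invariant, and attracting all bounded sets -/
def IsGlobalAttractor (L : ℝ) (S : ℝ → (Pt → Vec) → Pt → Vec)
    (𝒜 : Set (Pt → Vec)) : Prop :=
  (∀ g ∈ 𝒜, MemL2s L g) ∧ IsCompactL2 L 𝒜 ∧
    (∀ t : ℝ, 0 ≤ t → S t '' 𝒜 = 𝒜) ∧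
    ∀ B : Set (Pt → Vec), IsBoundedL2s L B → ∀ ε : ℝ, 0 < ε →
      ∃ T : ℝ, 0 < T ∧ ∀ t : ℝ, T < t → ∀ g ∈ B, ∃ a ∈ 𝒜, dL2 L (S t g) a < ε

/-- eternal solution (defined for all `t ∈ ℝ`) of the projected system -/
structure IsEternalSolGen (L ν α : ℝ) (Bmap : (Pt → Vec) → Pt → ℝ) (f : StatForce L)
    (u uα : ℝ → Pt → Vec) : Prop where
  uMem : ∀ t : ℝ, MemL2s L (u t)
  uLocBdd : ∀ T : ℝ, 0 < T → ∃ M : ℝ, ∀ t ∈ Set.Icc (-T) T, homSobSq L 0 (u t) ≤ M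
  uH1int : ∀ T : ℝ, 0 < T → IntegrableOn (fun t => homSobSq L 1 (u t)) (Set.Icc (-T) T)
  uaMem : ∀ t : ℝ, MemHs L 1 (uα t) ∧ DivFree L (uα t)
  momentum : WeakMomentumProjEternal L ν f.coef u uα
  filter : ∀ t : ℝ, FilterEq L α (Bmap (u t)) (uα t) (u t)

/-- eternal solution of the projected Navier–Stokes-alpha model (regularized filter) -/
def IsEternalSol (L ν α : ℝ) (A : Vec → ℝ) (φ : Pt → ℝ) (f : StatForce L)
    (u uα : ℝ → Pt → Vec) : Prop :=
  IsEternalSolGen L ν α (fun g x => A (pconv L φ g x)) f u uα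

/-- bounded eternal solution -/
def IsBoundedEternalSol (L ν α : ℝ) (A : Vec → ℝ) (φ : Pt → ℝ) (f : StatForce L)
    (u uα : ℝ → Pt → Vec) : Prop :=
  IsEternalSol L ν α A φ f u uα ∧ ∃ M : ℝ, ∀ t : ℝ, homSobSq L 0 (u t) ≤ M

/-- the pointwise bounds `β ≤ A ≤ 1` on the indicator function -/
def IndicatorBounds (β : ℝ) (A : Vec → ℝ) : Prop := ∀ x : Vec, β ≤ A x ∧ A x ≤ 1

/-- `A ∈ C^{0,1}(ℝ³)` (Lipschitz continuity) -/
def IndicatorC01 (A : Vec → ℝ) : Prop := ∃ C : ℝ, ∀ x y : Vec, |A x - A y| ≤ C * ‖x - y‖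

/-- `A ∈ C^{1,1}(ℝ³)` (continuously differentiable with bounded, Lipschitz derivative) -/
def IndicatorC11 (A : Vec → ℝ) : Prop :=
  ContDiff ℝ 1 A ∧ (∃ M : ℝ, ∀ x : Vec, ‖fderiv ℝ A x‖ ≤ M) ∧
    ∃ C : ℝ, ∀ x y : Vec, ‖fderiv ℝ A x - fderiv ℝ A y‖ ≤ C * ‖x - y‖

/-- `φ ∈ L²(𝕋³)` -/
def KernelL2 (L : ℝ) (φ : Pt → ℝ) : Prop :=
  SpacePeriodicS L φ ∧ IntegrableOn φ (box L) ∧ IntegrableOn (fun x => φ x ^ 2) (box L)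

/-- `‖φ‖_{L²(𝕋³)}` -/
def kernelL2Norm (L : ℝ) (φ : Pt → ℝ) : ℝ := Real.sqrt (∫ x in box L, φ x ^ 2)

/-- `‖φ‖²_{H¹(𝕋³)}` -/
def kernelH1Sq (L : ℝ) (φ : Pt → ℝ) : ℝ :=
  L ^ 3 * ∑' k : Lat, (1 + freqNormSq L k) * Complex.normSq (fcS L φ k)

/-- `φ ∈ H¹(𝕋³)` -/
def KernelH1 (L : ℝ) (φ : Pt → ℝ) : Prop :=
  KernelL2 L φ ∧ Summable fun k : Lat => (1 + freqNormSq L k) * Complex.normSq (fcS L φ k)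

/-- `‖φ‖_{H¹(𝕋³)}` -/
def kernelH1Norm (L : ℝ) (φ : Pt → ℝ) : ℝ := Real.sqrt (kernelH1Sq L φ)

/-- `‖∇A‖_{L^∞}` -/
def gradSup (A : Vec → ℝ) : ℝ := ⨆ x : Vec, ‖fderiv ℝ A x‖

/-- `sup_{0≤t≤T} ‖u(t)‖_{L²}` -/
def supNormL2 (L T : ℝ) (u : ℝ → Pt → Vec) : ℝ :=
  ⨆ t : Set.Icc (0 : ℝ) T, Real.sqrt (homSobSq L 0 (u ↑t))

/-- `sup_{0≤t≤T} ‖u(t)‖_{H¹}` -/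
def supNormH1 (L T : ℝ) (u : ℝ → Pt → Vec) : ℝ :=
  ⨆ t : Set.Icc (0 : ℝ) T, Real.sqrt (sobSq L 1 (u ↑t))

/-- the energy norm `‖u‖_{E_T}` -/
def eTNorm (L ν T : ℝ) (u : ℝ → Pt → Vec) : ℝ :=
  supNormL2 L T u + Real.sqrt (ν * ∫ t in Set.Ioc (0 : ℝ) T, homSobSq L 1 (u t))

/-- the constant `K₀ ≃ 1/min(α²β,1)` of the `H¹` filter estimate -/
def K0c (α β : ℝ) : ℝ := 1 / min (α ^ 2 * β) 1

/-- `L₁ = α² C_A ‖φ‖_{L²}` -/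
def L1c (L α CA : ℝ) (φ : Pt → ℝ) : ℝ := α ^ 2 * CA * kernelL2Norm L φ

/-- `L₂ = α² ‖∇A‖_{L^∞} ‖φ‖_{H¹}` -/
def L2c (L α : ℝ) (A : Vec → ℝ) (φ : Pt → ℝ) : ℝ := α ^ 2 * gradSup A * kernelH1Norm L φ

/-- `L₃ = α² ‖φ‖_{H¹} max(C′_A ‖φ‖_{H¹}, ‖∇A‖_{L^∞})` -/
def L3c (L α CA' : ℝ) (A : Vec → ℝ) (φ : Pt → ℝ) : ℝ :=
  α ^ 2 * kernelH1Norm L φ * max (CA' * kernelH1Norm L φ) (gradSup A)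

/-- `K₁ = max(K₀^{3/2} L₁, K₀)` -/
def K1c (L α β CA : ℝ) (φ : Pt → ℝ) : ℝ :=
  max (K0c α β ^ ((3 : ℝ) / 2) * L1c L α CA φ) (K0c α β)

/-- `K₂ = max(K₀^{3/2} L₂, K₀)` -/
def K2c (L α β : ℝ) (A : Vec → ℝ) (φ : Pt → ℝ) : ℝ :=
  max (K0c α β ^ ((3 : ℝ) / 2) * L2c L α A φ) (K0c α β)

/-- `K₃ = max(K₀K₂L₁, K₀K₁L₂, K₀^{3/2}L₃)` -/
def K3c (L α β CA CA' : ℝ) (A : Vec → ℝ) (φ : Pt → ℝ) : ℝ :=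
  max (max (K0c α β * K2c L α β A φ * L1c L α CA φ)
      (K0c α β * K1c L α β CA φ * L2c L α A φ))
    (K0c α β ^ ((3 : ℝ) / 2) * L3c L α CA' A φ)

/-- the quantity `K(α,β)` -/
def Kab (α β : ℝ) : ℝ :=
  if α ≤ 1 then 1 / (α ^ 5 * β ^ ((5 : ℝ) / 2))
  else if α ≤ 1 / Real.sqrt β then 1 / (α * β ^ ((5 : ℝ) / 2))
  else α ^ 4

/-- minimal number of `ε`-balls of `L²(𝕋³)` needed to cover `K` -/
def coveringNumber (L ε : ℝ) (K : Set (Pt → Vec)) : ℕ :=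
  sInf {n : ℕ | ∃ c : Fin n → Pt → Vec, ∀ g ∈ K, ∃ i, dL2 L g (c i) < ε}

/-- the fractal dimension `dim_f(K) = limsup_{ε→0⁺} N_ε(K)/ln(1/ε)` -/
def fractalDim (L : ℝ) (K : Set (Pt → Vec)) : ℝ :=
  Filter.limsup (fun ε : ℝ => (coveringNumber L ε K : ℝ) / Real.log (1 / ε))
    (nhdsWithin 0 (Set.Ioi 0))

/-- squared `L²` norm of the spectral projection `P_m` onto frequencies `|k| ≤ m` -/
def projNormSq (L : ℝ) (m : ℕ) (g : Pt → Vec) : ℝ :=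
  L ^ 3 * ∑' k : Lat,
    (if freqNormSq L k ≤ (m : ℝ) ^ 2 then (1 : ℝ) else 0) * cnormSq (fc L g k)

/-- test data for the weak-* topology of `L^∞(I, L²)` (elements of `L¹(I, L²)`) -/
def TestL1L2 (L : ℝ) (I : Set ℝ) (g : ℝ → Pt → Vec) : Prop :=
  (∀ t ∈ I, SpacePeriodic L (g t) ∧ IntegrableOn (g t) (box L) ∧ homSummable L 0 (g t)) ∧
    IntegrableOn (fun t => Real.sqrt (homSobSq L 0 (g t))) I

/-- test data for the weak topology of `L²(I, Ḣ¹)` (elements of `L²(I, Ḣ⁻¹)`),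
given as Fourier coefficients -/
def TestL2Hneg (L : ℝ) (I : Set ℝ) (c : ℝ → Lat → Fin 3 → ℂ) : Prop :=
  (∀ t ∈ I, Summable fun k : Lat => freqNormSq L k ^ (-(1 : ℝ)) * cnormSq (c t k)) ∧
    IntegrableOn (fun t => hNegSobSq L (c t)) I

/-- convergence in the weak-* topology of `E_T = L^∞([0,T],L²) ∩ L²([0,T],Ḣ¹)` -/
def WeakStarET (L T : ℝ) (un : ℕ → ℝ → Pt → Vec) (u : ℝ → Pt → Vec) : Prop :=
  (∀ g : ℝ → Pt → Vec, TestL1L2 L (Set.Ioc 0 T) g →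
    Tendsto (fun n => ∫ t in Set.Ioc (0 : ℝ) T, l2Pair L (un n t) (g t)) atTop
      (nhds (∫ t in Set.Ioc (0 : ℝ) T, l2Pair L (u t) (g t)))) ∧
  ∀ c : ℝ → Lat → Fin 3 → ℂ, TestL2Hneg L (Set.Ioc 0 T) c →
    Tendsto (fun n => ∫ t in Set.Ioc (0 : ℝ) T, pairing L (c t) (un n t)) atTop
      (nhds (∫ t in Set.Ioc (0 : ℝ) T, pairing L (c t) (u t)))

/-- scalar duality pairing `⟨c, g⟩` (with `c` given by Fourier coefficients) -/
def sPairCoef (L : ℝ) (c : Lat → ℂ) (g : Pt → ℝ) : ℝ :=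
  L ^ 3 * (∑' k : Lat, c k * starRingEnd ℂ (fcS L g k)).re

/-- scalar test data in `L²(I, Ḣ^{1/2})`, for the weak topology of `L²(I, Ḣ^{-1/2})` -/
def TestL2HhalfS (L : ℝ) (I : Set ℝ) (c : ℝ → Lat → ℂ) : Prop :=
  (∀ t ∈ I, Summable fun k : Lat => freqNormSq L k ^ ((1 : ℝ) / 2) * Complex.normSq (c t k)) ∧
    IntegrableOn
      (fun t => L ^ 3 * ∑' k : Lat, freqNormSq L k ^ ((1 : ℝ) / 2) * Complex.normSq (c t k)) I

/-- weak Leray solution of the classical Navier–Stokes equations,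
with pressure in `L²_loc Ḣ^{-1/2}` -/
structure IsLeraySolNSE (L ν : ℝ) (u₀ : Pt → Vec) (f : ForceData L)
    (u : ℝ → Pt → Vec) (P : ℝ → Pt → ℝ) : Prop where
  uMem : ∀ t : ℝ, 0 ≤ t → MemL2s L (u t)
  uLocBdd : ∀ T : ℝ, 0 < T → ∃ M : ℝ, ∀ t ∈ Set.Icc (0 : ℝ) T, homSobSq L 0 (u t) ≤ M
  uH1ae : ∀ T : ℝ, 0 < T →
    ∀ᵐ t ∂(volume.restrict (Set.Icc (0 : ℝ) T)), homSummable L 1 (u t)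
  uH1int : ∀ T : ℝ, 0 < T → IntegrableOn (fun t => homSobSq L 1 (u t)) (Set.Icc (0 : ℝ) T)
  pPeriodic : ∀ t : ℝ, 0 ≤ t → SpacePeriodicS L (P t)
  pIntegrable : ∀ t : ℝ, 0 ≤ t → IntegrableOn (P t) (box L)
  pLoc : ∀ T : ℝ, 0 < T →
    IntegrableOn (fun t => homSobSqS L (-(1 : ℝ) / 2) (P t)) (Set.Icc (0 : ℝ) T)
  momentum : WeakMomentum L ν f.coef u u P u₀
  energy : EnergyIneq L ν f.coef u u₀

/-- an approximation of the identity `(φ_n)` on the torus -/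
def IsApproxIdentity (L : ℝ) (φn : ℕ → Pt → ℝ) : Prop :=
  (∀ n, KernelL2 L (φn n) ∧ (∫ x in box L, φn n x) = 1) ∧
    ∀ g : Pt → Vec, SpacePeriodic L g → IntegrableOn g (box L) → homSummable L 0 g →
      Tendsto (fun n => homSobSq L 0 fun x i => pconv L (φn n) g x i - g x i)
        atTop (nhds 0)



/-- square-summable sequences on the lattice -/
abbrev ELL := lp (fun _ : Lat => ℂ) 2

lemma ell_hasSum_inner (x y : ELL) :
    HasSum (fun k => starRingEnd ℂ (x k) * y k) (inner ℂ x y) := by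
  have := lp.hasSum_inner (𝕜 := ℂ) x y
  refine this.congr_fun ?_
  intro k
  simp [RCLike.inner_apply, mul_comm]

lemma ell_hasSum_sq (x : ELL) : HasSum (fun k => ‖x k‖ ^ 2) (‖x‖ ^ 2) := by
  have := lp.hasSum_norm (p := 2) (by norm_num) x
  simpa using this

lemma ell_of_summable (f : Lat → ℂ) (hf : Summable fun k => ‖f k‖ ^ 2) :
    ∃ x : ELL, ∀ k, x k = f k := by
  refine ⟨⟨f, memℓp_gen (by simpa using hf)⟩, fun k => rfl⟩

lemma ell_mul (d : Lat → ℂ) (M : ℝ) (hd : ∀ k, ‖d k‖ ≤ M) (x : ELL) :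
    ∃ z : ELL, ∀ k, z k = d k * x k := by
  apply ell_of_summable
  refine Summable.of_nonneg_of_le (fun k => by positivity) (fun k => ?_)
    ((ell_hasSum_sq x).summable.mul_left (M ^ 2))
  rw [norm_mul, mul_pow]
  gcongr
  exact hd k

lemma core_energy (f : Lat → Fin 3 → ℝ) (c β : ℝ) (hc : 0 < c)
    (v y : ELL) (w : Fin 3 → ELL) (hw : ∀ a k, w a k = f k a * v k) (S : ELL → ELL)
    (hS : ∀ z, β * ‖z‖ ^ 2 ≤ (inner ℂ z (S z) : ℂ).re)
    (heq : ∀ k, (c : ℂ) * ∑ a, (f k a : ℂ) * S (w a) k = y k) :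
    c * β * ∑ a, ‖w a‖ ^ 2 ≤ (inner ℂ v y : ℂ).re := by
  have h1 : HasSum (fun k => starRingEnd ℂ (v k) * y k)
      ((c : ℂ) * ∑ a, inner ℂ (w a) (S (w a))) := by
    have := (hasSum_sum (s := Finset.univ)
      (fun a _ => ell_hasSum_inner (w a) (S (w a)))).mul_left (c : ℂ)
    refine this.congr_fun ?_
    intro k
    rw [← heq k, Finset.mul_sum, Finset.mul_sum, Finset.mul_sum]
    refine Finset.sum_congr rfl fun a _ => ?_
    rw [hw a k, map_mul, Complex.conj_ofReal]
    ring
  have h2 := (ell_hasSum_inner v y).unique h1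
  rw [h2, Complex.re_ofReal_mul, Complex.re_sum, mul_assoc, Finset.mul_sum]
  gcongr with a
  exact hS (w a)

lemma core_diff (f : Lat → Fin 3 → ℝ) (c β G h : ℝ) (hc : 0 < c) (hβ : 0 < β) (hG : 0 ≤ G)
    (hh : 0 ≤ h) (bb : Fin 3)
    (v y : ELL) (w : Fin 3 → ELL) (hw : ∀ a k, w a k = f k a * v k) (S S' : ELL →ₗ[ℂ] ELL)
    (hS' : ∀ z, β * ‖z‖ ^ 2 ≤ (inner ℂ z (S' z) : ℂ).re)
    (heq : ∀ k, (c : ℂ) * ∑ a, (f k a : ℂ) * S (w a) k = y k)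
    (d : Lat → ℂ) (hd2 : ∀ k, ‖d k‖ ≤ 2) (hd : ∀ k, ‖d k‖ ≤ h * |f k bb|)
    (hcomm : ∀ z z' : ELL, (∀ k, z' k = (1 + d k) * z k) → ∀ k, S' z' k = (1 + d k) * S z k)
    (hSS : ∀ z, ‖S' z - S z‖ ≤ G * h * ‖z‖)
    (D : Fin 3 → ELL) (hD : ∀ a k, D a k = d k * w a k) :
    c * β * √(∑ a, ‖D a‖ ^ 2) ≤ h * (‖y‖ + c * G * √(∑ a, ‖w a‖ ^ 2)) := by
  obtain ⟨dv, hdv⟩ := ell_mul d 2 hd2 v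
  obtain ⟨dy, hdy⟩ := ell_mul d 2 hd2 y
  set X := √(∑ a, ‖D a‖ ^ 2) with hX
  have hX2 : X ^ 2 = ∑ a, ‖D a‖ ^ 2 := Real.sq_sqrt (by positivity)
  have hX0 : 0 ≤ X := Real.sqrt_nonneg _
  -- the identity
  have hmain : (inner ℂ dv dy : ℂ) = (c : ℂ) * ∑ a, inner ℂ (D a) (S' (D a) + (S' (w a) - S (w a))) := by
    have h1 : HasSum (fun k => starRingEnd ℂ (dv k) * dy k)
        ((c : ℂ) * ∑ a, inner ℂ (D a) (S' (D a) + (S' (w a) - S (w a)))) := by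
      have := (hasSum_sum (s := Finset.univ)
        (fun a _ => ell_hasSum_inner (D a) (S' (D a) + (S' (w a) - S (w a))))).mul_left (c : ℂ)
      refine this.congr_fun ?_
      intro k
      rw [hdy k, ← heq k, Finset.mul_sum, Finset.mul_sum, Finset.mul_sum, Finset.mul_sum]
      refine Finset.sum_congr rfl fun a _ => ?_
      have h3 : (S' (D a) + (S' (w a) - S (w a))) k = d k * S (w a) k := by
        have h4 := hcomm (w a) (D a + w a) (by
          intro k
          simp only [lp.coeFn_add, Pi.add_apply, hD a k]
          ring) k
        rw [map_add] at h4
        simp only [lp.coeFn_add, lp.coeFn_sub, Pi.add_apply, Pi.sub_apply] at h4 ⊢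
        linear_combination h4
      rw [h3, hD a k, hw a k, hdv k, map_mul, map_mul, map_mul, Complex.conj_ofReal]
      ring
    exact (ell_hasSum_inner dv dy).unique h1
  -- upper bound
  have hup : (inner ℂ dv dy : ℂ).re ≤ h * X * ‖y‖ := by
    -- compare with absolute values
    obtain ⟨A1, hA1⟩ := ell_of_summable (fun k => ((‖D bb k‖ : ℝ) : ℂ))
      (by simpa using (ell_hasSum_sq (D bb)).summable)
    obtain ⟨A2, hA2⟩ := ell_of_summable (fun k => ((‖y k‖ : ℝ) : ℂ))
      (by simpa using (ell_hasSum_sq y).summable)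
    have n1 : ‖A1‖ = ‖D bb‖ := by
      have := (ell_hasSum_sq A1).unique (by simpa [hA1] using ell_hasSum_sq (D bb))
      exact (pow_left_inj₀ (norm_nonneg _) (norm_nonneg _) two_ne_zero).1 this
    have n2 : ‖A2‖ = ‖y‖ := by
      have := (ell_hasSum_sq A2).unique (by simpa [hA2] using ell_hasSum_sq y)
      exact (pow_left_inj₀ (norm_nonneg _) (norm_nonneg _) two_ne_zero).1 this
    have s1 := (Complex.hasSum_re (ell_hasSum_inner dv dy))
    have s2 := (Complex.hasSum_re (ell_hasSum_inner A1 A2)).mul_left h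
    have hle : (inner ℂ dv dy : ℂ).re ≤ h * (inner ℂ A1 A2 : ℂ).re := by
      refine hasSum_le (fun k => ?_) s1 s2
      refine (Complex.re_le_norm _).trans ?_
      rw [hA1, hA2, hdv, hdy, Complex.conj_ofReal, ← Complex.ofReal_mul, Complex.ofReal_re]
      rw [hD, hw]
      simp only [norm_mul, RCLike.norm_conj, Complex.norm_real, Real.norm_eq_abs]
      have := mul_le_mul_of_nonneg_right (hd k) (show 0 ≤ ‖v k‖ * (‖d k‖ * ‖y k‖) by positivity)
      nlinarith [this]
    have h5 : (inner ℂ A1 A2 : ℂ).re ≤ ‖D bb‖ * ‖y‖ := by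
      rw [← n1, ← n2]
      exact (Complex.re_le_norm _).trans (norm_inner_le_norm _ _)
    have h6 : ‖D bb‖ ≤ X := by
      apply Real.le_sqrt_of_sq_le
      exact Finset.single_le_sum (f := fun a => ‖D a‖ ^ 2) (fun a _ => by positivity)
        (Finset.mem_univ bb)
    calc (inner ℂ dv dy : ℂ).re ≤ h * (inner ℂ A1 A2 : ℂ).re := hle
      _ ≤ h * (‖D bb‖ * ‖y‖) := by gcongr
      _ ≤ h * (X * ‖y‖) := by gcongr
      _ = _ := by ring
  have hlow : c * (β * X ^ 2 - G * h * (X * √(∑ a, ‖w a‖ ^ 2))) ≤ (inner ℂ dv dy : ℂ).re := by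
    rw [hmain, Complex.re_ofReal_mul, Complex.re_sum]
    gcongr
    have h7 : ∑ a, ‖D a‖ * ‖w a‖ ≤ X * √(∑ a, ‖w a‖ ^ 2) :=
      Real.sum_mul_le_sqrt_mul_sqrt _ _ _
    calc β * X ^ 2 - G * h * (X * √(∑ a, ‖w a‖ ^ 2))
        ≤ β * X ^ 2 - G * h * ∑ a, ‖D a‖ * ‖w a‖ := by gcongr
      _ = ∑ a, (β * ‖D a‖ ^ 2 - ‖D a‖ * (G * h * ‖w a‖)) := by
          rw [hX2, Finset.mul_sum, Finset.mul_sum, ← Finset.sum_sub_distrib]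
          refine Finset.sum_congr rfl fun a _ => by ring
      _ ≤ _ := by
          refine Finset.sum_le_sum fun a _ => ?_
          rw [inner_add_right, Complex.add_re]
          have h8 := hS' (D a)
          have h9 : |(inner ℂ (D a) (S' (w a) - S (w a)) : ℂ).re| ≤ ‖D a‖ * (G * h * ‖w a‖) :=
            (Complex.abs_re_le_norm _).trans ((norm_inner_le_norm _ _).trans
              (by gcongr; exact hSS (w a)))
          have := neg_le_of_abs_le h9
          linarith
  rcases hX0.eq_or_lt with h0 | h0
  · rw [← h0]; simp only [mul_zero]; positivity
  · have := hlow.trans hup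
    refine le_of_mul_le_mul_right ?_ h0
    nlinarith [this]


lemma core_limit (f : Lat → Fin 3 → ℝ) (bb : Fin 3) (w : Fin 3 → ELL) (Q : ℝ)
    (H : ∀ h : ℝ, 0 < h → ∀ D : Fin 3 → ELL,
      (∀ a k, D a k = (Complex.exp (Complex.I * ((h * f k bb : ℝ) : ℂ)) - 1) * w a k) →
      √(∑ a, ‖D a‖ ^ 2) ≤ h * Q) (F : Finset Lat) :
    ∑ k ∈ F, f k bb ^ 2 * ∑ a, ‖w a k‖ ^ 2 ≤ Q ^ 2 := by
  have hlim : ∀ k, Tendsto (fun h : ℝ =>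
      ‖(h : ℂ)⁻¹ * (Complex.exp (Complex.I * ((h * f k bb : ℝ) : ℂ)) - 1)‖ ^ 2)
      (𝓝[>] 0) (𝓝 (f k bb ^ 2)) := by
    intro k
    have h1 : HasDerivAt (fun h : ℝ => Complex.exp (Complex.I * ((h * f k bb : ℝ) : ℂ)))
        (Complex.I * (f k bb : ℂ)) 0 := by
      have h2 : HasDerivAt (fun h : ℝ => Complex.I * ((h * f k bb : ℝ) : ℂ))
          (Complex.I * (f k bb : ℂ)) 0 := by
        have := (((hasDerivAt_id (0 : ℝ)).mul_const (f k bb)).ofReal_comp).const_mul Complex.I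
        simpa using this
      simpa using h2.cexp
    have h3 := h1.tendsto_slope_zero_right
    have h4 := (h3.norm).pow 2
    have e : ‖Complex.I * (f k bb : ℂ)‖ ^ 2 = f k bb ^ 2 := by simp
    rw [e] at h4
    refine h4.congr fun h => ?_
    simp
  have hlim2 := tendsto_finsetSum F (fun k _ => (hlim k).mul_const (∑ a, ‖w a k‖ ^ 2))
  refine le_of_tendsto hlim2 ?_
  filter_upwards [self_mem_nhdsWithin] with h hh
  have hh : 0 < h := hh
  choose D hD using fun a => ell_mul
    (fun k => Complex.exp (Complex.I * ((h * f k bb : ℝ) : ℂ)) - 1) 2 (fun k => by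
      refine (norm_sub_le _ _).trans ?_
      rw [mul_comm, Complex.norm_exp_ofReal_mul_I]; norm_num) (w a)
  have h5 := H h hh D hD
  have h6 : ∑ a, ‖D a‖ ^ 2 ≤ (h * Q) ^ 2 := by
    have := Real.sqrt_le_left (Real.sqrt_nonneg _ |>.trans h5) |>.1 h5
    exact this
  have h7 : ∑ k ∈ F, ∑ a, ‖D a k‖ ^ 2 ≤ ∑ a, ‖D a‖ ^ 2 := by
    rw [Finset.sum_comm]
    refine Finset.sum_le_sum fun a _ => ?_
    exact sum_le_hasSum F (fun k _ => by positivity) (ell_hasSum_sq (D a))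
  have h8 : ∑ k ∈ F, ‖(h : ℂ)⁻¹ * (Complex.exp (Complex.I * ((h * f k bb : ℝ) : ℂ)) - 1)‖ ^ 2 *
      ∑ a, ‖w a k‖ ^ 2 = (h⁻¹) ^ 2 * ∑ k ∈ F, ∑ a, ‖D a k‖ ^ 2 := by
    rw [Finset.mul_sum]
    refine Finset.sum_congr rfl fun k _ => ?_
    rw [Finset.mul_sum, Finset.mul_sum]
    refine Finset.sum_congr rfl fun a _ => ?_
    rw [hD, norm_mul, norm_mul, norm_inv, Complex.norm_real, Real.norm_eq_abs, abs_of_pos hh]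
    ring
  rw [h8]
  calc (h⁻¹) ^ 2 * ∑ k ∈ F, ∑ a, ‖D a k‖ ^ 2 ≤ (h⁻¹) ^ 2 * (h * Q) ^ 2 := by
        gcongr; exact h7.trans h6
    _ = Q ^ 2 := by field_simp

/-- the unit torus -/
abbrev TT := UnitAddTorus (Fin 3)

/-- normalized Haar measure on the unit torus -/
def muT : Measure TT := Measure.pi fun _ => AddCircle.haarAddCircle

instance : IsProbabilityMeasure muT := by unfold muT; infer_instance
instance : Measure.IsAddHaarMeasure muT := by unfold muT; infer_instance

/-- Fourier coefficients on the unit torus -/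
def tco (g : TT → ℂ) (k : Lat) : ℂ := ∫ θ, UnitAddTorus.mFourier (-k) θ * g θ ∂muT

/-- exponentials in `L²` -/
def eT (k : Lat) : Lp ℂ 2 muT := ContinuousMap.toLp (E := ℂ) 2 muT ℂ (UnitAddTorus.mFourier k)

lemma eT_orthonormal : Orthonormal ℂ eT :=
  UnitAddTorus.orthonormal_mFourier (d := Fin 3)

lemma eT_span : (Submodule.span ℂ (Set.range eT)).topologicalClosure = ⊤ :=
  UnitAddTorus.span_mFourierLp_closure_eq_top (d := Fin 3) (p := 2) (by simp)

/-- the Fourier Hilbert basis -/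
def bT : HilbertBasis Lat ℂ (Lp ℂ 2 muT) := HilbertBasis.mk eT_orthonormal eT_span.ge

lemma bT_coe (k : Lat) : bT k = eT k := by
  unfold bT; rw [HilbertBasis.coe_mk]

/-- multiplication operator -/
def mulOp (B : C(TT, ℂ)) (z : Lp ℂ 2 muT) : Lp ℂ 2 muT :=
  (ContinuousMap.toLp (E := ℂ) ⊤ muT ℂ B • z : Lp ℂ 2 muT)

lemma mulOp_coe (B : C(TT, ℂ)) (z : Lp ℂ 2 muT) : mulOp B z =ᵐ[muT] fun x => B x * z x := by
  unfold mulOp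
  filter_upwards [Lp.coeFn_lpSMul (r := 2) (ContinuousMap.toLp (E := ℂ) ⊤ muT ℂ B) z,
    ContinuousMap.coeFn_toLp (p := ⊤) (𝕜 := ℂ) muT B] with x h1 h2
  rw [h1, Pi.smul_apply', h2, smul_eq_mul]

lemma mulOp_norm (B : C(TT, ℂ)) (δ : ℝ) (hδ : 0 ≤ δ) (hB : ∀ x, ‖B x‖ ≤ δ) (z : Lp ℂ 2 muT) :
    ‖mulOp B z‖ ≤ δ * ‖z‖ := by
  apply Lp.norm_le_mul_norm_of_ae_le_mul
  filter_upwards [mulOp_coe B z] with x hx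
  rw [hx, norm_mul]
  gcongr
  exact hB x

lemma mulOp_sub (B B' : C(TT, ℂ)) (z : Lp ℂ 2 muT) : mulOp (B - B') z = mulOp B z - mulOp B' z := by
  apply Lp.ext
  filter_upwards [mulOp_coe (B - B') z, mulOp_coe B z, mulOp_coe B' z,
    Lp.coeFn_sub (mulOp B z) (mulOp B' z)] with x h1 h2 h3 h4
  rw [h4, h1, Pi.sub_apply, h2, h3, ContinuousMap.sub_apply]
  ring

/-- multiplication operator as a continuous linear map -/
def mulCLM (B : C(TT, ℂ)) : Lp ℂ 2 muT →L[ℂ] Lp ℂ 2 muT :=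
  LinearMap.mkContinuous
    { toFun := mulOp B
      map_add' := fun z z' => by
        apply Lp.ext
        filter_upwards [mulOp_coe B (z + z'), mulOp_coe B z, mulOp_coe B z',
          Lp.coeFn_add (mulOp B z) (mulOp B z'), Lp.coeFn_add z z'] with x h1 h2 h3 h4 h5
        rw [h4, h1, Pi.add_apply, h2, h3, h5, Pi.add_apply]
        ring
      map_smul' := fun c z => by
        apply Lp.ext
        filter_upwards [mulOp_coe B (c • z), mulOp_coe B z,
          Lp.coeFn_smul c (mulOp B z), Lp.coeFn_smul c z] with x h1 h2 h4 h5
        rw [RingHom.id_apply, h4, h1, Pi.smul_apply, h2, h5, Pi.smul_apply]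
        simp only [smul_eq_mul]
        ring }
    ‖B‖ (fun z => mulOp_norm B ‖B‖ (norm_nonneg _) (fun x => B.norm_coe_le_norm x) z)

lemma mulCLM_apply (B : C(TT, ℂ)) (z : Lp ℂ 2 muT) : mulCLM B z = mulOp B z := rfl

/-- multiplication operator on the Fourier side -/
def conOp (B : C(TT, ℂ)) : ELL →ₗ[ℂ] ELL :=
  (bT.repr.toLinearEquiv : Lp ℂ 2 muT →ₗ[ℂ] ELL) ∘ₗ (mulCLM B : Lp ℂ 2 muT →ₗ[ℂ] Lp ℂ 2 muT) ∘ₗ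
    (bT.repr.symm.toLinearEquiv : ELL →ₗ[ℂ] Lp ℂ 2 muT)

lemma conOp_apply (B : C(TT, ℂ)) (z : ELL) :
    conOp B z = bT.repr (mulOp B (bT.repr.symm z)) := rfl

lemma inner_eT_mulOp (B : C(TT, ℂ)) (k m : Lat) :
    (inner ℂ (eT k) (mulOp B (eT m)) : ℂ) = tco B (k - m) := by
  rw [L2.inner_def, tco]
  apply integral_congr_ae
  filter_upwards [mulOp_coe B (eT m),
    ContinuousMap.coeFn_toLp (p := 2) (𝕜 := ℂ) muT (UnitAddTorus.mFourier k),
    ContinuousMap.coeFn_toLp (p := 2) (𝕜 := ℂ) muT (UnitAddTorus.mFourier m)] with x h1 h2 h3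
  change inner ℂ ((ContinuousMap.toLp (E := ℂ) 2 muT ℂ (UnitAddTorus.mFourier k)) x) _ = _
  rw [h1, h2]
  change inner ℂ _ (B x * (ContinuousMap.toLp (E := ℂ) 2 muT ℂ (UnitAddTorus.mFourier m)) x) = _
  rw [h3, RCLike.inner_apply, ← UnitAddTorus.mFourier_neg, neg_sub,
    sub_eq_add_neg, UnitAddTorus.mFourier_add]
  ring

lemma conOp_hasSum (B : C(TT, ℂ)) (z : ELL) (k : Lat) :
    HasSum (fun m => tco B (k - m) * z m) (conOp B z k) := by
  have h1 := bT.hasSum_repr_symm z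
  have h2 := ((innerSL ℂ (eT k)).comp (mulCLM B)).hasSum h1
  have e : ((innerSL ℂ (eT k)).comp (mulCLM B)) (bT.repr.symm z) = conOp B z k := by
    rw [conOp_apply, HilbertBasis.repr_apply_apply, bT_coe]; rfl
  rw [e] at h2
  refine h2.congr_fun fun m => ?_
  have : ((innerSL ℂ (eT k)).comp (mulCLM B)) (bT m) = tco B (k - m) := by
    rw [bT_coe, ← inner_eT_mulOp]; rfl
  simp only [Function.comp_apply, map_smul, this, smul_eq_mul]
  ring

lemma conOp_coercive (B : C(TT, ℂ)) (b : TT → ℝ) (hb : ∀ x, B x = b x) (β : ℝ)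
    (hβ : ∀ x, β ≤ b x) (z : ELL) :
    β * ‖z‖ ^ 2 ≤ (inner ℂ z (conOp B z) : ℂ).re := by
  set Z := bT.repr.symm z with hZ
  have hz : z = bT.repr Z := by simp [hZ]
  have e1 : (inner ℂ z (conOp B z) : ℂ) = inner ℂ Z (mulOp B Z) := by
    rw [conOp_apply, ← hZ]
    conv_lhs => rw [hz]
    exact bT.repr.inner_map_map _ _
  have e2 : ‖z‖ = ‖Z‖ := by rw [hz]; exact bT.repr.norm_map Z
  have e3 : ‖Z‖ ^ 2 = (inner ℂ Z Z : ℂ).re := (inner_self_eq_norm_sq (𝕜 := ℂ) Z).symm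
  rw [e1, e2, e3, L2.inner_def, L2.inner_def]
  have i1 := L2.integrable_inner (𝕜 := ℂ) Z Z
  have i2 := L2.integrable_inner (𝕜 := ℂ) Z (mulOp B Z)
  have r1 := integral_re i1
  have r2 := integral_re i2
  change ∫ a, (inner ℂ (Z a) (Z a) : ℂ).re ∂muT = Complex.re _ at r1
  change ∫ a, (inner ℂ (Z a) (mulOp B Z a) : ℂ).re ∂muT = Complex.re _ at r2
  rw [← r1, ← r2, ← integral_const_mul]
  refine integral_mono_ae (i1.re.const_mul β) i2.re ?_
  filter_upwards [mulOp_coe B Z] with x hx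
  change β * (inner ℂ (Z x) (Z x) : ℂ).re ≤ (inner ℂ (Z x) (mulOp B Z x) : ℂ).re
  have h0 : 0 ≤ (inner ℂ (Z x) (Z x) : ℂ).re := inner_self_nonneg (𝕜 := ℂ) (x := Z x)
  have h1 : (inner ℂ (Z x) (mulOp B Z x) : ℂ) = (b x : ℂ) * inner ℂ (Z x) (Z x) := by
    rw [hx, hb x, ← smul_eq_mul, inner_smul_right]
  rw [h1, Complex.re_ofReal_mul]
  exact mul_le_mul_of_nonneg_right (hβ x) h0

lemma conOp_diff (B B' : C(TT, ℂ)) (δ : ℝ) (hδ : 0 ≤ δ) (h : ∀ x, ‖B' x - B x‖ ≤ δ) (z : ELL) :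
    ‖conOp B' z - conOp B z‖ ≤ δ * ‖z‖ := by
  rw [conOp_apply, conOp_apply, ← map_sub, LinearIsometryEquiv.norm_map, ← mulOp_sub]
  refine (mulOp_norm (B' - B) δ hδ h _).trans ?_
  rw [LinearIsometryEquiv.norm_map]

lemma mF_add_arg (k : Lat) (x y : TT) : UnitAddTorus.mFourier k (x + y) =
    UnitAddTorus.mFourier k x * UnitAddTorus.mFourier k y := by
  simp only [UnitAddTorus.mFourier, ContinuousMap.coe_mk, Pi.add_apply, fourier_apply, smul_add,
    AddCircle.toCircle_add, Circle.coe_mul, Finset.prod_mul_distrib]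

lemma mF_norm (k : Lat) (x : TT) : ‖UnitAddTorus.mFourier k x‖ = 1 := by
  simp only [UnitAddTorus.mFourier, ContinuousMap.coe_mk, fourier_apply, norm_prod]
  exact Finset.prod_eq_one fun b _ => Circle.norm_coe _

lemma mF_neg_mul (k : Lat) (x : TT) :
    UnitAddTorus.mFourier (-k) x * UnitAddTorus.mFourier k x = 1 := by
  rw [← UnitAddTorus.mFourier_add, neg_add_cancel, UnitAddTorus.mFourier_zero]; rfl

lemma tco_translate (B B' : TT → ℂ) (s : TT) (h : ∀ x, B' x = B (x + s)) (k : Lat) :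
    tco B' k = UnitAddTorus.mFourier k s * tco B k := by
  unfold tco
  rw [← integral_const_mul,
    ← integral_add_right_eq_self (μ := muT)
      (fun θ => UnitAddTorus.mFourier k s * (UnitAddTorus.mFourier (-k) θ * B θ)) s]
  refine integral_congr_ae (Eventually.of_forall fun θ => ?_)
  simp only [h θ, mF_add_arg]
  linear_combination (-UnitAddTorus.mFourier (-k) θ * B (θ + s)) * (mF_neg_mul k s)

lemma conOp_comm (B B' : C(TT, ℂ)) (s : TT) (h : ∀ x, B' x = B (x + s)) (z z' : ELL)
    (hz : ∀ k, z' k = UnitAddTorus.mFourier k s * z k) (k : Lat) :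
    conOp B' z' k = UnitAddTorus.mFourier k s * conOp B z k := by
  refine (conOp_hasSum B' z' k).unique ?_
  refine ((conOp_hasSum B z k).mul_left _).congr_fun fun m => ?_
  rw [tco_translate B B' s h, hz m]
  have : UnitAddTorus.mFourier k s = UnitAddTorus.mFourier (k - m) s * UnitAddTorus.mFourier m s := by
    rw [← UnitAddTorus.mFourier_add, sub_add_cancel]
  rw [this]; ring


lemma integral_cont_zero (g : TT → ℂ) (hg : Integrable g muT) (h0 : ∀ k, tco g k = 0)
    (c : C(TT, ℂ)) : ∫ θ, c θ * g θ ∂muT = 0 := by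
  have hint : ∀ c : C(TT, ℂ), Integrable (fun θ => c θ * g θ) muT := fun c =>
    hg.bdd_mul (c := ‖c‖) c.continuous.aestronglyMeasurable
      (Eventually.of_forall fun x => c.norm_coe_le_norm x)
  let Φ : C(TT, ℂ) →L[ℂ] ℂ := LinearMap.mkContinuous
    { toFun := fun c => ∫ θ, c θ * g θ ∂muT
      map_add' := fun c c' => by
        rw [← integral_add (hint c) (hint c')]
        simp [add_mul]
      map_smul' := fun a c => by
        rw [RingHom.id_apply, smul_eq_mul, ← integral_const_mul]
        simp [mul_assoc] }
    (∫ θ, ‖g θ‖ ∂muT) (fun c => by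
      refine (norm_integral_le_integral_norm _).trans ?_
      rw [mul_comm, ← integral_const_mul]
      refine integral_mono (hint c).norm (hg.norm.const_mul _) fun x => ?_
      simp only [norm_mul]
      gcongr
      exact c.norm_coe_le_norm x)
  have hker : (Submodule.span ℂ (Set.range (UnitAddTorus.mFourier (d := Fin 3)))).topologicalClosure
      ≤ LinearMap.ker (Φ : C(TT, ℂ) →ₗ[ℂ] ℂ) := by
    refine Submodule.topologicalClosure_minimal _ ?_ Φ.isClosed_ker
    rw [Submodule.span_le]
    rintro _ ⟨k, rfl⟩
    have := h0 (-k)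
    rw [tco, neg_neg] at this
    exact this
  rw [UnitAddTorus.span_mFourier_closure_eq_top] at hker
  exact hker (Submodule.mem_top : c ∈ ⊤)

lemma tco_inj (g : TT → ℂ) (hg : Integrable g muT) (h0 : ∀ k, tco g k = 0) : g =ᵐ[muT] 0 := by
  refine ae_eq_zero_of_forall_setIntegral_isClosed_eq_zero hg (fun s hs => ?_)
  have hc := thickenedIndicator_tendsto_indicator_closure
    (δseq := fun n : ℕ => 1 / ((n : ℝ) + 1)) (fun n => by positivity)
    tendsto_one_div_add_atTop_nhds_zero_nat s
  rw [hs.closure_eq, tendsto_pi_nhds] at hc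
  have h1 : Tendsto (fun n : ℕ => ∫ θ, (((thickenedIndicator (δ := 1 / ((n : ℝ) + 1))
      (by positivity) s θ : NNReal) : ℝ) : ℂ) * g θ ∂muT) atTop (𝓝 (∫ θ, s.indicator g θ ∂muT)) := by
    refine tendsto_integral_of_dominated_convergence (fun θ => ‖g θ‖) (fun n => ?_) hg.norm
      (fun n => Eventually.of_forall fun θ => ?_) (Eventually.of_forall fun θ => ?_)
    · refine AEStronglyMeasurable.mul (Continuous.aestronglyMeasurable ?_) hg.1
      exact Complex.continuous_ofReal.comp (NNReal.continuous_coe.comp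
        (thickenedIndicator (δ := 1 / ((n : ℝ) + 1)) (by positivity) s).continuous)
    · rw [norm_mul, Complex.norm_real, Real.norm_eq_abs, abs_of_nonneg NNReal.zero_le_coe]
      refine mul_le_of_le_one_left (norm_nonneg _) ?_
      exact_mod_cast thickenedIndicator_le_one (δ := 1 / ((n : ℝ) + 1)) (by positivity) s θ
    · have h2 := (((Complex.continuous_ofReal.comp NNReal.continuous_coe).tendsto _).comp
        (hc θ)).mul_const (g θ)
      have h5 : s.indicator g θ = (Complex.ofReal ∘ NNReal.toReal)
          (s.indicator (fun _ => (1 : NNReal)) θ) * g θ := by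
        by_cases hθ : θ ∈ s <;> simp [hθ]
      rw [h5]
      exact h2
  have h3 : ∀ n : ℕ, ∫ θ, (((thickenedIndicator (δ := 1 / ((n : ℝ) + 1))
      (by positivity) s θ : NNReal) : ℝ) : ℂ) * g θ ∂muT = 0 := fun n =>
    integral_cont_zero g hg h0 ⟨fun θ => (((thickenedIndicator (δ := 1 / ((n : ℝ) + 1))
      (by positivity) s θ : NNReal) : ℝ) : ℂ), Complex.continuous_ofReal.comp
        (NNReal.continuous_coe.comp
        (thickenedIndicator (δ := 1 / ((n : ℝ) + 1)) (by positivity) s).continuous)⟩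
  simp only [h3] at h1
  rw [← integral_indicator hs.measurableSet]
  exact (tendsto_nhds_unique tendsto_const_nhds h1).symm

lemma conv_coeff (f g : TT → ℂ) (hf : Integrable f muT) (hg : Integrable g muT) :
    Integrable (fun θ => ∫ η, f η * g (θ - η) ∂muT) muT ∧
    ∀ k, tco (fun θ => ∫ η, f η * g (θ - η) ∂muT) k = tco f k * tco g k := by
  have key : ∀ k, ∀ f : TT → ℂ, Integrable f muT → Integrable (fun θ => UnitAddTorus.mFourier k θ * f θ) muT :=
    fun k f hf => hf.bdd_mul (c := 1) (UnitAddTorus.mFourier k).continuous.aestronglyMeasurable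
      (Eventually.of_forall fun x => (mF_norm k x).le)
  refine ⟨?_, fun k => ?_⟩
  · exact hf.integrable_convolution (ContinuousLinearMap.mul ℂ ℂ) hg
  · have h1 := integral_convolution (ContinuousLinearMap.mul ℂ ℂ) (μ := muT) (ν := muT)
      (key (-k) f hf) (key (-k) g hg)
    rw [ContinuousLinearMap.mul_apply'] at h1
    unfold tco
    rw [← h1]
    refine integral_congr_ae (Eventually.of_forall fun θ => ?_)
    simp only [convolution_def, ContinuousLinearMap.mul_apply']
    rw [← integral_const_mul]
    refine integral_congr_ae (Eventually.of_forall fun η => ?_)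
    have : UnitAddTorus.mFourier (-k) θ = UnitAddTorus.mFourier (-k) η * UnitAddTorus.mFourier (-k) (θ - η) := by
      rw [← mF_add_arg, add_sub_cancel]
    simp only [this]; ring

/-- absolutely convergent Fourier series -/
lemma fourier_series_cont (c : Lat → ℂ) (hc : Summable fun k => ‖c k‖) :
    ∃ H : C(TT, ℂ), (∀ θ, HasSum (fun k => c k * UnitAddTorus.mFourier k θ) (H θ)) ∧
      ∀ k, tco H k = c k := by
  have hs : Summable (fun k => c k • UnitAddTorus.mFourier (d := Fin 3) k) := by
    refine Summable.of_norm ?_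
    simpa [norm_smul, UnitAddTorus.mFourier_norm] using hc
  obtain ⟨H, hH⟩ := hs
  refine ⟨H, fun θ => ?_, fun k => ?_⟩
  · simpa using (ContinuousMap.evalCLM ℂ θ).hasSum hH
  · have h1 := ((innerSL ℂ (eT k)).comp (ContinuousMap.toLp (E := ℂ) 2 muT ℂ)).hasSum hH
    have e2 : ∀ G : C(TT, ℂ), ((innerSL ℂ (eT k)).comp (ContinuousMap.toLp (E := ℂ) 2 muT ℂ)) G
        = tco G k := by
      intro G
      change (inner ℂ (ContinuousMap.toLp (E := ℂ) 2 muT ℂ (UnitAddTorus.mFourier k))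
        (ContinuousMap.toLp (E := ℂ) 2 muT ℂ G) : ℂ) = _
      rw [ContinuousMap.inner_toLp, tco]
      refine integral_congr_ae (Eventually.of_forall fun θ => ?_)
      simp only [UnitAddTorus.mFourier_neg]
      ring
    rw [e2] at h1
    refine h1.unique ?_
    have h3 : ∀ m, ((innerSL ℂ (eT k)).comp (ContinuousMap.toLp (E := ℂ) 2 muT ℂ))
        (c m • UnitAddTorus.mFourier m) = if m = k then c k else 0 := by
      intro m
      rw [map_smul]
      change c m • (inner ℂ (eT k) (eT m) : ℂ) = _
      rw [orthonormal_iff_ite.1 eT_orthonormal]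
      by_cases h : k = m
      · subst h; simp
      · simp [h, Ne.symm h]
    have h4 := hasSum_ite_eq k (c k)
    exact h4.congr_fun h3


/-- section of the covering map of the torus -/
def sec (L : ℝ) (θ : TT) : Pt := fun i => L * (AddCircle.equivIoc 1 0 (θ i)).1

lemma coe_equivIoc_self (t : UnitAddCircle) :
    (((AddCircle.equivIoc 1 0 t).1 : ℝ) : UnitAddCircle) = t :=
  (AddCircle.equivIoc (1 : ℝ) 0).symm_apply_apply t

lemma sec_aux (L : ℝ) (hL : 0 < L) : MeasurableEmbedding (sec L) ∧
    Measure.map (sec L) muT = ENNReal.ofReal ((L ^ 3)⁻¹) • volume.restrict (box L) := by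
  have hL0 : L ≠ 0 := hL.ne'
  let S : Set Pt := {x | ∀ i, x i ∈ Set.Ioc (0 : ℝ) (0 + 1)}
  let e : TT ≃ᵐ S := UnitAddTorus.measurableEquivPiIoc (fun _ : Fin 3 => (0 : ℝ))
  have hS : MeasurableSet S := MeasurableSet.univ_pi' fun i => measurableSet_Ioc
  have hsm : MeasurableEmbedding (fun x : Pt => L • x) :=
    (Homeomorph.smulOfNeZero L hL0).measurableEmbedding
  have hsec : sec L = (fun x : Pt => L • x) ∘ (Subtype.val : S → Pt) ∘ e := by
    ext θ i; rfl
  have hemb : MeasurableEmbedding (sec L) := by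
    rw [hsec]
    exact hsm.comp ((MeasurableEmbedding.subtype_coe hS).comp e.measurableEmbedding)
  refine ⟨hemb, ?_⟩
  have h1 : Measure.map e muT = Measure.comap (Subtype.val : S → Pt) volume :=
    (UnitAddTorus.measurePreserving_equivPiIoc (fun _ : Fin 3 => (0 : ℝ))).map_eq
  have h2 : Measure.map (Subtype.val : S → Pt) (Measure.map e muT) = volume.restrict S := by
    rw [h1]; exact map_comap_subtype_coe hS _
  have h3 : Measure.map (sec L) muT = Measure.map (fun x : Pt => L • x)
      (Measure.map (Subtype.val : S → Pt) (Measure.map e muT)) := by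
    have q1 := Measure.map_map (μ := muT) (g := (Subtype.val : S → Pt)) (f := e)
      measurable_subtype_coe e.measurable
    have q2 := Measure.map_map (μ := muT) (g := (fun x : Pt => L • x))
      (f := (Subtype.val : S → Pt) ∘ e) hsm.measurable (measurable_subtype_coe.comp e.measurable)
    exact ((congrArg (fun m => Measure.map (fun x : Pt => L • x) m) q1).trans q2).symm
  rw [h3, h2]
  have hpre : S = (fun x : Pt => L • x) ⁻¹' (Set.univ.pi fun _ => Set.Ioc (0 : ℝ) L) := by
    ext x
    simp only [S, Set.mem_setOf_eq, Set.mem_preimage, Set.mem_univ_pi, Pi.smul_apply, smul_eq_mul,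
      Set.mem_Ioc, zero_add]
    refine forall_congr' fun i => ?_
    constructor
    · rintro ⟨h1, h2⟩; exact ⟨by positivity, by nlinarith⟩
    · rintro ⟨h1, h2⟩; exact ⟨pos_of_mul_pos_right h1 hL.le |>.trans_le le_rfl, by
        by_contra h; push Not at h; nlinarith⟩
  rw [hpre, ← hsm.restrict_map, Measure.map_addHaar_smul _ hL0]
  have hae : (Set.univ.pi fun _ : Fin 3 => Set.Ioc (0 : ℝ) L) =ᵐ[volume] box L := by
    have := Measure.univ_pi_Ioc_ae_eq_Icc (μ := fun _ : Fin 3 => (volume : Measure ℝ))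
      (f := fun _ => (0 : ℝ)) (g := fun _ => L)
    rw [← Set.pi_univ_Icc] at this
    exact this
  rw [Measure.restrict_smul, Measure.restrict_congr_set hae]
  congr 2
  simp [abs_of_pos hL]

lemma sec_integral {E : Type*} [NormedAddCommGroup E] [NormedSpace ℝ E] (L : ℝ) (hL : 0 < L)
    (F : Pt → E) : ∫ θ, F (sec L θ) ∂muT = (L ^ 3)⁻¹ • ∫ x in box L, F x := by
  obtain ⟨h1, h2⟩ := sec_aux L hL
  rw [← h1.integral_map, h2, integral_smul_measure, ENNReal.toReal_ofReal (by positivity)]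

lemma sec_integrable {E : Type*} [NormedAddCommGroup E] (L : ℝ) (hL : 0 < L)
    (F : Pt → E) (hF : IntegrableOn F (box L)) : Integrable (fun θ => F (sec L θ)) muT := by
  obtain ⟨h1, h2⟩ := sec_aux L hL
  refine Integrable.comp_measurable (f := sec L) (g := F) ?_ h1.measurable
  rw [h2]
  exact Integrable.smul_measure hF ENNReal.ofReal_ne_top

lemma mF_coe (k : Lat) (x : Fin 3 → ℝ) (θ : TT) (h : ∀ i, θ i = (x i : UnitAddCircle)) :
    UnitAddTorus.mFourier k θ = Complex.exp (Complex.I * ((∑ i, 2 * π * k i * x i : ℝ) : ℂ)) := by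
  simp only [UnitAddTorus.mFourier, ContinuousMap.coe_mk, h, fourier_coe_apply]
  rw [← Complex.exp_sum]
  congr 1
  push_cast
  rw [Finset.mul_sum]
  refine Finset.sum_congr rfl fun i _ => ?_
  ring

lemma em_sec (L : ℝ) (hL : 0 < L) (k : Lat) (θ : TT) :
    em L k (sec L θ) = UnitAddTorus.mFourier (-k) θ := by
  rw [mF_coe (-k) (fun i => (AddCircle.equivIoc 1 0 (θ i)).1) θ
    (fun i => (coe_equivIoc_self (θ i)).symm), em]
  have hh : (∑ i, 2 * π * ((-k) i : ℤ) * (AddCircle.equivIoc (1 : ℝ) 0 (θ i)).1 : ℝ) =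
      -(∑ i, freq L k i * sec L θ i) := by
    rw [← Finset.sum_neg_distrib (f := fun i => freq L k i * sec L θ i)]
    refine Finset.sum_congr rfl fun i _ => ?_
    simp only [freq, sec, Pi.neg_apply]
    push_cast
    field_simp
  rw [hh, Complex.ofReal_neg, neg_mul, mul_neg]

lemma fcS_eq (L : ℝ) (hL : 0 < L) (g : Pt → ℝ) (k : Lat) :
    fcS L g k = tco (fun θ => (g (sec L θ) : ℂ)) k := by
  unfold fcS tco
  rw [← sec_integral L hL]
  simp only [em_sec L hL]

lemma sec_sub (L : ℝ) (θ η : TT) : ∃ n : Lat,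
    (fun i => sec L θ i - sec L η i) = fun i => sec L (θ - η) i + L * (n i : ℝ) := by
  have : ∀ i, ∃ n : ℤ, (AddCircle.equivIoc (1 : ℝ) 0 (θ i)).1 - (AddCircle.equivIoc (1 : ℝ) 0 (η i)).1
      = (AddCircle.equivIoc (1 : ℝ) 0 ((θ - η) i)).1 + n := by
    intro i
    have h : (((AddCircle.equivIoc (1 : ℝ) 0 (θ i)).1 - (AddCircle.equivIoc (1 : ℝ) 0 (η i)).1
      - (AddCircle.equivIoc (1 : ℝ) 0 ((θ - η) i)).1 : ℝ) : UnitAddCircle) = 0 := by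
      rw [AddCircle.coe_sub, AddCircle.coe_sub, coe_equivIoc_self, coe_equivIoc_self,
        coe_equivIoc_self, Pi.sub_apply, sub_self]
    obtain ⟨n, hn⟩ := (AddCircle.coe_eq_zero_iff (1 : ℝ)).1 h
    refine ⟨n, ?_⟩
    simp only [zsmul_eq_mul, mul_one] at hn
    linarith
  choose n hn using this
  refine ⟨n, funext fun i => ?_⟩
  simp only [sec, ← mul_sub, hn i]
  ring

lemma pconv_sec (L : ℝ) (hL : 0 < L) (φ : Pt → ℝ) (g : Pt → Vec) (hg : SpacePeriodic L g)
    (θ : TT) (i : Fin 3) :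
    ((pconv L φ g (sec L θ) i : ℝ) : ℂ) =
      (L ^ 3 : ℝ) * ∫ η, (φ (sec L η) : ℂ) * (g (sec L (θ - η)) i : ℂ) ∂muT := by
  have h1 : pconv L φ g (sec L θ) i = L ^ 3 * ∫ η, φ (sec L η) * g (sec L (θ - η)) i ∂muT := by
    have h2 := sec_integral L hL (fun y => φ y * g (fun a => sec L θ a - y a) i)
    have h3 : ∀ η, g (fun a => sec L θ a - sec L η a) = g (sec L (θ - η)) := by
      intro η
      obtain ⟨n, hn⟩ := sec_sub L θ η
      rw [hn, hg]
    simp only [h3, smul_eq_mul] at h2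
    rw [h2, pconv]
    field_simp
  rw [h1, Complex.ofReal_mul, ← integral_complex_ofReal]
  simp only [Complex.ofReal_mul]

lemma pconv_series (L : ℝ) (hL : 0 < L) (φ : Pt → ℝ) (g : Pt → Vec) (hφ : IntegrableOn φ (box L))
    (hg : SpacePeriodic L g) (hgi : IntegrableOn g (box L)) (i : Fin 3)
    (hs : Summable fun k => ‖((L ^ 3 : ℝ) : ℂ) * (fcS L φ k * fc L g k i)‖) :
    ∃ H : C(TT, ℂ), (∀ θ, HasSum (fun k => ((L ^ 3 : ℝ) : ℂ) * (fcS L φ k * fc L g k i) *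
        UnitAddTorus.mFourier k θ) (H θ)) ∧
      ∀ᵐ θ ∂muT, pconv L φ g (sec L θ) i = (H θ).re := by
  obtain ⟨H, hH1, hH2⟩ := fourier_series_cont _ hs
  refine ⟨H, hH1, ?_⟩
  have i1 : Integrable (fun θ => (φ (sec L θ) : ℂ)) muT := (sec_integrable L hL φ hφ).ofReal
  have i2 : Integrable (fun θ => (g (sec L θ) i : ℂ)) muT :=
    (sec_integrable L hL (fun x => g x i) (Integrable.eval hgi i)).ofReal
  obtain ⟨c1, c2⟩ := conv_coeff _ _ i1 i2
  have hz := tco_inj (fun θ => ((L ^ 3 : ℝ) : ℂ) *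
      (∫ η, (φ (sec L η) : ℂ) * (g (sec L (θ - η)) i : ℂ) ∂muT) - H θ)
    ((c1.const_mul _).sub (H.continuous.integrable_of_hasCompactSupport
      (HasCompactSupport.of_compactSpace _))) (fun k => by
      have hm : ∀ f : TT → ℂ, Integrable f muT →
        Integrable (fun θ => UnitAddTorus.mFourier (-k) θ * f θ) muT := fun f hf =>
          hf.bdd_mul (c := 1) (UnitAddTorus.mFourier (-k)).continuous.aestronglyMeasurable
          (Eventually.of_forall fun x => (mF_norm (-k) x).le)
      have e1 := c2 k
      have e2 := hH2 k
      rw [← fcS_eq L hL, ← fcS_eq L hL (fun x => g x i)] at e1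
      unfold tco at e1 e2 ⊢
      simp only [mul_sub]
      rw [integral_sub (hm _ (c1.const_mul _)) (hm _ (H.continuous.integrable_of_hasCompactSupport
      (HasCompactSupport.of_compactSpace _))), e2]
      simp only [mul_left_comm _ ((L ^ 3 : ℝ) : ℂ) _]
      rw [integral_const_mul, e1]
      exact sub_self _)
  filter_upwards [hz] with θ hθ
  have h1 := pconv_sec L hL φ g hg θ i
  have h2 : H θ = ((pconv L φ g (sec L θ) i : ℝ) : ℂ) := by
    rw [h1]; exact (sub_eq_zero.1 hθ).symm
  rw [h2, Complex.ofReal_re]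


/-- translation by `h` in direction `b` on the unit torus -/
def tr (L h : ℝ) (bb : Fin 3) : TT := fun i => ((if i = bb then h / L else 0 : ℝ) : UnitAddCircle)

lemma mF_tr (L h : ℝ) (bb : Fin 3) (k : Lat) :
    UnitAddTorus.mFourier k (tr L h bb) =
      Complex.exp (Complex.I * ((h * freq L k bb : ℝ) : ℂ)) := by
  rw [mF_coe k (fun i => if i = bb then h / L else 0) (tr L h bb) (fun i => rfl)]
  have : (∑ i, 2 * π * k i * (if i = bb then h / L else 0) : ℝ) = h * freq L k bb := by
    simp [freq]; ring
  rw [this]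

set_option maxHeartbeats 400000 in
lemma comp_bound (L c β G K : ℝ) (hc : 0 < c) (hβ : 0 < β) (hG : 0 ≤ G)
    (hK : 1 ≤ K) (hK2 : 1 ≤ K * (c * β))
    (B : C(TT, ℂ)) (b : TT → ℝ) (hb : ∀ x, B x = b x) (hbβ : ∀ x, β ≤ b x)
    (hLip : ∀ (bb : Fin 3) (h : ℝ), 0 < h → ∀ θ, ‖B (θ + tr L h bb) - B θ‖ ≤ G * h)
    (v g : Lat → ℂ) (hw : Summable fun k => (1 + freqNormSq L k) * ‖v k‖ ^ 2)
    (hg : Summable fun k => ‖g k‖ ^ 2)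
    (heq : ∀ k, (c : ℂ) * ∑' m : Lat, ((∑ a, freq L k a * freq L m a : ℝ) : ℂ) *
        tco B (fun a => k a - m a) * v m + v k = g k) (F : Finset Lat) :
    ∑ k ∈ F, (1 + freqNormSq L k) ^ 2 * ‖v k‖ ^ 2 ≤
      8 * (K + K * √K * (c * G)) ^ 2 * ∑' k, ‖g k‖ ^ 2 := by
  have hfn : ∀ k, 0 ≤ freqNormSq L k := fun k => Finset.sum_nonneg fun i _ => sq_nonneg _
  obtain ⟨V, hV⟩ := ell_of_summable v (Summable.of_nonneg_of_le (fun k => by positivity)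
    (fun k => by nlinarith [hfn k, sq_nonneg ‖v k‖]) hw)
  obtain ⟨g', hg'⟩ := ell_of_summable g hg
  have hWe : ∀ a, ∃ x : ELL, ∀ k, x k = freq L k a * v k := fun a => by
    refine ell_of_summable (fun k => freq L k a * v k) (Summable.of_nonneg_of_le (fun k => by positivity)
      (fun k => ?_) hw)
    rw [norm_mul, mul_pow, Complex.norm_real, Real.norm_eq_abs, sq_abs]
    have : freq L k a ^ 2 ≤ freqNormSq L k :=
      Finset.single_le_sum (f := fun i => freq L k i ^ 2) (fun i _ => sq_nonneg _) (Finset.mem_univ a)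
    gcongr
    linarith
  choose w hwv using hWe
  obtain ⟨y, hy⟩ : ∃ y : ELL, y = g' - V := ⟨_, rfl⟩
  have hwV : ∀ a k, w a k = freq L k a * V k := fun a k => by rw [hwv, hV]
  have heq' : ∀ k, (c : ℂ) * ∑ a, (freq L k a : ℂ) * conOp B (w a) k = y k := by
    intro k
    have h1 : HasSum (fun m => ∑ a, (freq L k a : ℂ) * (tco B (k - m) * w a m))
        (∑ a, (freq L k a : ℂ) * conOp B (w a) k) :=
      hasSum_sum fun a _ => (conOp_hasSum B (w a) k).mul_left _
    have h2 := heq k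
    have h3 : (∑' m : Lat, ((∑ a, freq L k a * freq L m a : ℝ) : ℂ) *
        tco B (fun a => k a - m a) * v m) = ∑ a, (freq L k a : ℂ) * conOp B (w a) k := by
      rw [← h1.tsum_eq]
      refine tsum_congr fun m => ?_
      rw [Complex.ofReal_sum, Finset.sum_mul, Finset.sum_mul]
      refine Finset.sum_congr rfl fun a _ => ?_
      rw [hwv, Complex.ofReal_mul]
      change _ * tco B (k - m) * _ = _
      ring
    rw [h3] at h2
    have h4 : y k = g' k - V k := by rw [hy]; rfl
    rw [h4, hg', hV, ← h2]
    ring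
  have hco := conOp_coercive B b hb β hbβ
  have en := core_energy (freq L) c β hc V y w hwV (conOp B) hco heq'
  have hgn : ‖g'‖ ^ 2 = ‖V‖ ^ 2 + 2 * (inner ℂ V y : ℂ).re + ‖y‖ ^ 2 := by
    have : g' = V + y := by rw [hy]; abel
    rw [this]; exact norm_add_sq (𝕜 := ℂ) V y
  obtain ⟨N, hN⟩ : ∃ N, N = √(∑ a, ‖w a‖ ^ 2) := ⟨_, rfl⟩
  have hN0 : 0 ≤ N := by rw [hN]; exact Real.sqrt_nonneg _
  have hN2 : N ^ 2 = ∑ a, ‖w a‖ ^ 2 := by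
    rw [hN]; exact Real.sq_sqrt (Finset.sum_nonneg fun a _ => sq_nonneg _)
  rw [← hN2] at en
  have hcb : 0 < c * β := by positivity
  have hcN : 0 ≤ c * β * N ^ 2 := mul_nonneg hcb.le (sq_nonneg N)
  have yg : ‖y‖ ≤ ‖g'‖ := by
    apply le_of_sq_le_sq _ (norm_nonneg _)
    nlinarith [sq_nonneg ‖V‖]
  have vg : ‖V‖ ^ 2 ≤ ‖g'‖ ^ 2 := by nlinarith [sq_nonneg ‖y‖]
  have Ng : N ≤ √K * ‖g'‖ := by
    apply le_of_sq_le_sq _ (by positivity)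
    rw [mul_pow, Real.sq_sqrt (by linarith)]
    have : c * β * N ^ 2 ≤ ‖g'‖ ^ 2 := by nlinarith [sq_nonneg ‖y‖, sq_nonneg ‖V‖]
    calc N ^ 2 ≤ K * (c * β) * N ^ 2 := by nlinarith [sq_nonneg N]
      _ = K * (c * β * N ^ 2) := by ring
      _ ≤ _ := by gcongr
  obtain ⟨P, hP⟩ : ∃ P, P = K + K * √K * (c * G) := ⟨_, rfl⟩
  rw [← hP]
  have hP1 : 1 ≤ P := by
    have : 0 ≤ K * √K * (c * G) := by positivity
    linarith
  have key : ∀ bb : Fin 3, ∑ k ∈ F, freq L k bb ^ 2 * ∑ a, ‖w a k‖ ^ 2 ≤ (P * ‖g'‖) ^ 2 := by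
    intro bb
    apply core_limit
    intro h hh D hD
    let B' : C(TT, ℂ) := ⟨fun θ => B (θ + tr L h bb), by fun_prop⟩
    have hmf := mF_tr L h bb
    have := core_diff (freq L) c β G h hc hβ hG hh.le bb V y w hwV (conOp B) (conOp B')
      (conOp_coercive B' (fun θ => b (θ + tr L h bb)) (fun x => hb _) β (fun x => hbβ _)) heq'
      (fun k => Complex.exp (Complex.I * ((h * freq L k bb : ℝ) : ℂ)) - 1)
      (fun k => by
        rw [← hmf]
        refine (norm_sub_le _ _).trans ?_
        rw [mF_norm]; norm_num)
      (fun k => by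
        refine (Real.norm_exp_I_mul_ofReal_sub_one_le (x := h * freq L k bb)).trans ?_
        rw [Real.norm_eq_abs, abs_mul, abs_of_pos hh])
      (fun z z' hz k => by
        have := conOp_comm B B' (tr L h bb) (fun x => rfl) z z'
          (fun k => by rw [hz, hmf]; ring) k
        rw [this, hmf]; ring)
      (fun z => conOp_diff B B' (G * h) (by positivity) (fun x => hLip bb h hh x) z)
      D hD
    rw [← hN] at this
    have h5 : ‖y‖ + c * G * N ≤ (1 + √K * (c * G)) * ‖g'‖ := by
      have := mul_le_mul_of_nonneg_left Ng (by positivity : 0 ≤ c * G)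
      nlinarith
    obtain ⟨X, hX⟩ : ∃ X, X = √(∑ a, ‖D a‖ ^ 2) := ⟨_, rfl⟩
    rw [← hX] at this ⊢
    have hX0 : 0 ≤ X := by rw [hX]; exact Real.sqrt_nonneg _
    calc X ≤ K * (c * β) * X := by nlinarith
      _ = K * (c * β * X) := by ring
      _ ≤ K * (h * ((1 + √K * (c * G)) * ‖g'‖)) := by
          have : c * β * X ≤ h * ((1 + √K * (c * G)) * ‖g'‖) :=
            this.trans (mul_le_mul_of_nonneg_left h5 hh.le)
          gcongr
      _ = h * (P * ‖g'‖) := by rw [hP]; ring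
  have hsum : ∑ k ∈ F, freqNormSq L k ^ 2 * ‖v k‖ ^ 2 ≤ 3 * (P * ‖g'‖) ^ 2 := by
    have h6 : ∀ k, freqNormSq L k ^ 2 * ‖v k‖ ^ 2 =
        ∑ bb, freq L k bb ^ 2 * ∑ a, ‖w a k‖ ^ 2 := by
      intro k
      rw [← Finset.sum_mul]
      have : ∑ a, ‖w a k‖ ^ 2 = freqNormSq L k * ‖v k‖ ^ 2 := by
        rw [freqNormSq, Finset.sum_mul]
        refine Finset.sum_congr rfl fun a _ => ?_
        rw [hwv, norm_mul, mul_pow, Complex.norm_real, Real.norm_eq_abs, sq_abs]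
      rw [this, freqNormSq]; ring
    simp only [h6]
    rw [Finset.sum_comm]
    refine (Finset.sum_le_sum fun bb _ => key bb).trans ?_
    simp
  have hv0 : ∑ k ∈ F, ‖v k‖ ^ 2 ≤ ‖g'‖ ^ 2 := by
    refine le_trans ?_ vg
    have := sum_le_hasSum F (fun k _ => sq_nonneg ‖V k‖) (ell_hasSum_sq V)
    simpa only [hV] using this
  have hgt : ∑' k, ‖g k‖ ^ 2 = ‖g'‖ ^ 2 := by
    rw [← (ell_hasSum_sq g').tsum_eq]; simp only [hg']
  rw [hgt]
  calc ∑ k ∈ F, (1 + freqNormSq L k) ^ 2 * ‖v k‖ ^ 2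
      ≤ ∑ k ∈ F, (2 * ‖v k‖ ^ 2 + 2 * (freqNormSq L k ^ 2 * ‖v k‖ ^ 2)) := by
        refine Finset.sum_le_sum fun k _ => ?_
        have : (1 + freqNormSq L k) ^ 2 ≤ 2 + 2 * freqNormSq L k ^ 2 := by
          nlinarith [sq_nonneg (1 - freqNormSq L k)]
        nlinarith [mul_le_mul_of_nonneg_right this (sq_nonneg ‖v k‖)]
    _ = 2 * ∑ k ∈ F, ‖v k‖ ^ 2 + 2 * ∑ k ∈ F, freqNormSq L k ^ 2 * ‖v k‖ ^ 2 := by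
        rw [Finset.sum_add_distrib, Finset.mul_sum, Finset.mul_sum]
    _ ≤ 2 * ‖g'‖ ^ 2 + 2 * (3 * (P * ‖g'‖) ^ 2) := by gcongr
    _ ≤ _ := by
        have : ‖g'‖ ^ 2 ≤ P ^ 2 * ‖g'‖ ^ 2 := by
          have : 1 ≤ P ^ 2 := by nlinarith
          nlinarith [sq_nonneg ‖g'‖]
        nlinarith


lemma cs_tsum (f g : Lat → ℝ) (hf0 : ∀ k, 0 ≤ f k) (hg0 : ∀ k, 0 ≤ g k)
    (hf : Summable fun k => f k ^ 2) (hg : Summable fun k => g k ^ 2) :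
    (Summable fun k => f k * g k) ∧ ∑' k, f k * g k ≤ √(∑' k, f k ^ 2) * √(∑' k, g k ^ 2) := by
  have hpq : (2 : ℝ).HolderConjugate 2 := Real.HolderConjugate.two_two
  have h1 := Real.summable_mul_of_Lp_Lq_of_nonneg hpq hf0 hg0 (by simpa using hf) (by simpa using hg)
  have h2 := Real.inner_le_Lp_mul_Lq_tsum_of_nonneg hpq hf0 hg0 (by simpa using hf) (by simpa using hg)
  refine ⟨h1, ?_⟩
  simpa [Real.sqrt_eq_rpow] using h2

lemma cnormSq_nonneg' (c : Fin 3 → ℂ) : 0 ≤ cnormSq c :=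
  Finset.sum_nonneg fun i _ => Complex.normSq_nonneg _

lemma comp_summable (L : ℝ) (g : Pt → Vec) (hg : homSummable L 0 g) (i : Fin 3) :
    (Summable fun k => ‖fc L g k i‖ ^ 2) ∧
      ∑' k, ‖fc L g k i‖ ^ 2 ≤ ∑' k, cnormSq (fc L g k) := by
  have h0 : Summable fun k => cnormSq (fc L g k) := by simpa [homSummable] using hg
  have hle : ∀ k, ‖fc L g k i‖ ^ 2 ≤ cnormSq (fc L g k) := fun k => by
    rw [← Complex.normSq_eq_norm_sq]
    exact Finset.single_le_sum (f := fun i => Complex.normSq (fc L g k i))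
      (fun i _ => Complex.normSq_nonneg _) (Finset.mem_univ i)
  have h1 := Summable.of_nonneg_of_le (fun k => by positivity) hle h0
  exact ⟨h1, h1.tsum_le_tsum hle h0⟩

lemma coef_bound (L : ℝ) (hL : 0 < L) (φ : Pt → ℝ) (g : Pt → Vec) (hφ : KernelH1 L φ)
    (hg : homSummable L 0 g) (i : Fin 3) :
    ∃ e : Lat → ℝ, Summable e ∧ (∀ k, ‖((L ^ 3 : ℝ) : ℂ) * (fcS L φ k * fc L g k i)‖ ≤ e k) ∧
      (∀ k bb, ‖((L ^ 3 : ℝ) : ℂ) * (fcS L φ k * fc L g k i)‖ * |freq L k bb| ≤ e k) ∧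
      ∑' k, e k ≤ kernelH1Norm L φ * √(homSobSq L 0 g) := by
  have hfn : ∀ k, 0 ≤ freqNormSq L k := fun k => Finset.sum_nonneg fun i _ => sq_nonneg _
  obtain ⟨hg1, hg2⟩ := comp_summable L g hg i
  have hsq : ∀ k, (√(1 + freqNormSq L k) * ‖fcS L φ k‖) ^ 2 =
      (1 + freqNormSq L k) * Complex.normSq (fcS L φ k) := fun k => by
    rw [mul_pow, Real.sq_sqrt (by linarith [hfn k]), Complex.normSq_eq_norm_sq]
  obtain ⟨h1, h2⟩ := cs_tsum (fun k => √(1 + freqNormSq L k) * ‖fcS L φ k‖) (fun k => ‖fc L g k i‖)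
    (fun k => by positivity) (fun k => by positivity) (by simpa only [hsq] using hφ.2) hg1
  simp only [hsq] at h2
  have hL3 : 0 < L ^ 3 := by positivity
  have hnorm : ∀ k, ‖((L ^ 3 : ℝ) : ℂ) * (fcS L φ k * fc L g k i)‖ =
      L ^ 3 * (‖fcS L φ k‖ * ‖fc L g k i‖) := fun k => by
    rw [norm_mul, norm_mul, Complex.norm_real, Real.norm_eq_abs, abs_of_pos hL3]
  refine ⟨fun k => L ^ 3 * (√(1 + freqNormSq L k) * ‖fcS L φ k‖ * ‖fc L g k i‖), h1.mul_left _,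
    fun k => ?_, fun k bb => ?_, ?_⟩
  · rw [hnorm]
    have : 1 ≤ √(1 + freqNormSq L k) := Real.one_le_sqrt.2 (by linarith [hfn k])
    refine mul_le_mul_of_nonneg_left (mul_le_mul_of_nonneg_right ?_ (norm_nonneg _)) hL3.le
    nlinarith [norm_nonneg (fcS L φ k)]
  · rw [hnorm]
    have : |freq L k bb| ≤ √(1 + freqNormSq L k) := by
      apply Real.abs_le_sqrt
      have : freq L k bb ^ 2 ≤ freqNormSq L k :=
        Finset.single_le_sum (f := fun i => freq L k i ^ 2) (fun i _ => sq_nonneg _)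
          (Finset.mem_univ bb)
      linarith
    calc L ^ 3 * (‖fcS L φ k‖ * ‖fc L g k i‖) * |freq L k bb|
        ≤ L ^ 3 * (‖fcS L φ k‖ * ‖fc L g k i‖) * √(1 + freqNormSq L k) := by gcongr
      _ = _ := by ring
  · rw [tsum_mul_left, kernelH1Norm, kernelH1Sq, homSobSq]
    simp only [Real.rpow_zero, one_mul]
    rw [Real.sqrt_mul hL3.le, Real.sqrt_mul hL3.le]
    have h3 : √(∑' k, ‖fc L g k i‖ ^ 2) ≤ √(∑' k, cnormSq (fc L g k)) := Real.sqrt_le_sqrt hg2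
    have h4 := h2.trans (mul_le_mul_of_nonneg_left h3 (Real.sqrt_nonneg _))
    have h5 := mul_le_mul_of_nonneg_left h4 hL3.le
    refine h5.trans (le_of_eq ?_)
    have := Real.mul_self_sqrt hL3.le
    linear_combination -(√(∑' k, (1 + freqNormSq L k) * Complex.normSq (fcS L φ k)) *
      √(∑' k, cnormSq (fc L g k))) * this

lemma coeff_B (L β : ℝ) (hL : 0 < L) (A : Vec → ℝ) (φ : Pt → ℝ) (g : Pt → Vec)
    (hA : IndicatorBounds β A) (hA2 : IndicatorC11 A) (hφ : KernelH1 L φ) (hg : MemL2s L g) :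
    ∃ (B : C(TT, ℂ)) (b : TT → ℝ), (∀ x, B x = b x) ∧ (∀ x, β ≤ b x) ∧
      (∀ k, fcS L (fun x => A (pconv L φ g x)) k = tco B k) ∧
      ∀ (bb : Fin 3) (h : ℝ), 0 < h → ∀ θ, ‖B (θ + tr L h bb) - B θ‖ ≤
        gradSup A * (kernelH1Norm L φ * √(homSobSq L 0 g)) * h := by
  obtain ⟨gp, gi, -, -, gs⟩ := hg
  choose e he1 he2 he3 he4 using coef_bound L hL φ g hφ gs
  have hsum : ∀ i, Summable fun k => ‖((L ^ 3 : ℝ) : ℂ) * (fcS L φ k * fc L g k i)‖ := fun i =>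
    Summable.of_nonneg_of_le (fun k => norm_nonneg _) (he2 i) (he1 i)
  choose H hH1 hH2 using fun i => pconv_series L hL φ g hφ.1.2.1 gp gi i (hsum i)
  have hAc : Continuous A := hA2.1.continuous
  let b : TT → ℝ := fun θ => A (fun i => (H i θ).re)
  have hbc : Continuous b := hAc.comp (continuous_pi fun i =>
    Complex.continuous_re.comp (H i).continuous)
  refine ⟨⟨fun θ => (b θ : ℂ), Complex.continuous_ofReal.comp hbc⟩, b, fun x => rfl,
    fun x => (hA _).1, fun k => ?_, fun bb h hh θ => ?_⟩
  · rw [fcS_eq L hL]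
    unfold tco
    apply integral_congr_ae
    filter_upwards [eventually_countable_forall.2 hH2] with θ hθ
    have : pconv L φ g (sec L θ) = fun i => (H i θ).re := funext hθ
    simp only [this, ContinuousMap.coe_mk, b]
  · change ‖((b (θ + tr L h bb) : ℝ) : ℂ) - ((b θ : ℝ) : ℂ)‖ ≤ _
    rw [← Complex.ofReal_sub, Complex.norm_real]
    obtain ⟨M, hM⟩ := hA2.2.1
    have hbd : BddAbove (Set.range fun x : Vec => ‖fderiv ℝ A x‖) :=
      ⟨M, by rintro _ ⟨x, rfl⟩; exact hM x⟩
    have hG : ∀ x, ‖fderiv ℝ A x‖ ≤ gradSup A := fun x => le_ciSup hbd x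
    have hG0 : 0 ≤ gradSup A := (norm_nonneg _).trans (hG 0)
    have hmv := Convex.norm_image_sub_le_of_norm_fderiv_le (𝕜 := ℝ) (f := A) (s := Set.univ)
      (C := gradSup A)
      (fun x _ => hA2.1.differentiable one_ne_zero x) (fun x _ => hG x) convex_univ
      (Set.mem_univ (fun i => (H i θ).re)) (Set.mem_univ (fun i => (H i (θ + tr L h bb)).re))
    refine hmv.trans ?_
    rw [mul_assoc]
    refine mul_le_mul_of_nonneg_left ?_ hG0
    have hk0 : 0 ≤ kernelH1Norm L φ := Real.sqrt_nonneg _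
    rw [pi_norm_le_iff_of_nonneg (by positivity)]
    intro i
    have hs1 := (hH1 i (θ + tr L h bb)).sub (hH1 i θ)
    have hle : ∀ k, ‖((L ^ 3 : ℝ) : ℂ) * (fcS L φ k * fc L g k i) *
        UnitAddTorus.mFourier k (θ + tr L h bb) - ((L ^ 3 : ℝ) : ℂ) * (fcS L φ k * fc L g k i) *
        UnitAddTorus.mFourier k θ‖ ≤ h * e i k := by
      intro k
      rw [mF_add_arg, ← mul_sub, norm_mul (((L ^ 3 : ℝ) : ℂ) * (fcS L φ k * fc L g k i)), ← mul_sub_one,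
        norm_mul (UnitAddTorus.mFourier k θ), mF_norm, one_mul, mF_tr]
      have h1 := Real.norm_exp_I_mul_ofReal_sub_one_le (x := h * freq L k bb)
      rw [Real.norm_eq_abs, abs_mul, abs_of_pos hh] at h1
      calc _ ≤ ‖((L ^ 3 : ℝ) : ℂ) * (fcS L φ k * fc L g k i)‖ * (h * |freq L k bb|) := by gcongr
        _ = h * (‖((L ^ 3 : ℝ) : ℂ) * (fcS L φ k * fc L g k i)‖ * |freq L k bb|) := by ring
        _ ≤ _ := by gcongr; exact he3 i k bb
    have hb2 : ‖H i (θ + tr L h bb) - H i θ‖ ≤ h * ∑' k, e i k := by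
      rw [← hs1.tsum_eq]
      exact tsum_of_norm_bounded ((he1 i).hasSum.mul_left h) hle
    calc ‖((H i (θ + tr L h bb)).re - (H i θ).re : ℝ)‖ = |(H i (θ + tr L h bb) - H i θ).re| := by
          rw [Complex.sub_re, Real.norm_eq_abs]
      _ ≤ ‖H i (θ + tr L h bb) - H i θ‖ := Complex.abs_re_le_norm _
      _ ≤ h * ∑' k, e i k := hb2
      _ ≤ h * (kernelH1Norm L φ * √(homSobSq L 0 g)) := by gcongr; exact he4 i
      _ = _ := by ring


lemma K0c_facts (α β : ℝ) (hα : 0 < α) (hβ : 0 < β) :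
    1 ≤ K0c α β ∧ 1 ≤ K0c α β * (α ^ 2 * β) := by
  have hp : 0 < α ^ 2 * β := by positivity
  have hm : 0 < min (α ^ 2 * β) 1 := lt_min hp one_pos
  unfold K0c
  refine ⟨(one_le_div hm).2 (min_le_right _ _), ?_⟩
  rw [one_div_mul_eq_div]
  exact (one_le_div hm).2 (min_le_left _ _)

lemma final_bound (L α β : ℝ) (A : Vec → ℝ) (φ : Pt → ℝ) (g v : Pt → Vec)
    (hL : 0 < L) (hα : 0 < α) (hβ : 0 < β)
    (hA : IndicatorBounds β A) (hA2 : IndicatorC11 A) (hφ : KernelH1 L φ)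
    (hg : MemL2s L g) (hv : MemHs L 1 v)
    (hf : FilterEq L α (fun x => A (pconv L φ g x)) v g) :
    sobSummable L 2 v ∧ Real.sqrt (sobSq L 2 v) ≤ 3 * K2c L α β A φ *
      (Real.sqrt (homSobSq L 0 g) + 1) * Real.sqrt (homSobSq L 0 g) := by
  have hfn : ∀ k, 0 ≤ freqNormSq L k := fun k => Finset.sum_nonneg fun i _ => sq_nonneg _
  obtain ⟨hK1, hK2⟩ := K0c_facts α β hα hβ
  obtain ⟨B, b, hb, hbβ, hcoef, hLip⟩ := coeff_B L β hL A φ g hA hA2 hφ hg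
  obtain ⟨U, hU⟩ : ∃ U, U = √(homSobSq L 0 g) := ⟨_, rfl⟩
  have hU0 : 0 ≤ U := by rw [hU]; exact Real.sqrt_nonneg _
  have hG0 : 0 ≤ gradSup A := Real.iSup_nonneg fun x => norm_nonneg _
  have hk0 : 0 ≤ kernelH1Norm L φ := Real.sqrt_nonneg _
  rw [← hU] at hLip ⊢
  obtain ⟨K, hK⟩ : ∃ K, K = K0c α β := ⟨_, rfl⟩
  rw [← hK] at hK1 hK2
  obtain ⟨P, hP⟩ : ∃ P, P = K + K * √K * (α ^ 2 * (gradSup A * (kernelH1Norm L φ * U))) := ⟨_, rfl⟩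
  have hgs : homSummable L 0 g := hg.2.2.2.2
  have hvs : sobSummable L 1 v := hv.2.2.2
  have hcn : ∀ c : Fin 3 → ℂ, cnormSq c = ∑ i, ‖c i‖ ^ 2 := fun c => by
    simp only [cnormSq, Complex.normSq_eq_norm_sq]
  have hcomp : ∀ (i : Fin 3) (F : Finset Lat), ∑ k ∈ F, (1 + freqNormSq L k) ^ 2 * ‖fc L v k i‖ ^ 2 ≤
      8 * P ^ 2 * ∑' k, ‖fc L g k i‖ ^ 2 := by
    intro i F
    rw [hP]
    refine comp_bound L (α ^ 2) β _ K (by positivity) hβ (by positivity) hK1 hK2 B b hb hbβ hLip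
      (fun k => fc L v k i) (fun k => fc L g k i) ?_ (comp_summable L g hgs i).1 ?_ F
    · refine Summable.of_nonneg_of_le (fun k => mul_nonneg (by linarith [hfn k]) (sq_nonneg _))
        (fun k => ?_) hvs
      rw [Real.rpow_one, hcn]
      refine mul_le_mul_of_nonneg_left ?_ (by linarith [hfn k])
      exact Finset.single_le_sum (f := fun i => ‖fc L v k i‖ ^ 2)
        (fun i _ => sq_nonneg _) (Finset.mem_univ i)
    · intro k
      have := hf k i
      unfold filterLHS at this
      simp only [hcoef] at this
      exact this
  have htot : ∀ F : Finset Lat, ∑ k ∈ F, (1 + freqNormSq L k) ^ (2 : ℝ) * cnormSq (fc L v k) ≤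
      8 * P ^ 2 * ∑' k, cnormSq (fc L g k) := by
    intro F
    simp only [hcn, Real.rpow_two]
    rw [Summable.tsum_finsetSum (fun i _ => (comp_summable L g hgs i).1), Finset.mul_sum]
    simp only [Finset.mul_sum]
    rw [Finset.sum_comm]
    exact Finset.sum_le_sum fun i _ => hcomp i F
  have hnn : ∀ k, 0 ≤ (1 + freqNormSq L k) ^ (2 : ℝ) * cnormSq (fc L v k) := fun k =>
    mul_nonneg (Real.rpow_nonneg (by linarith [hfn k]) _)
      (Finset.sum_nonneg fun i _ => Complex.normSq_nonneg _)
  refine ⟨summable_of_sum_le hnn htot, ?_⟩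
  have hts := Real.tsum_le_of_sum_le hnn htot
  have hL3 : 0 < L ^ 3 := by positivity
  have hU2 : U ^ 2 = L ^ 3 * ∑' k, cnormSq (fc L g k) := by
    have h0 : homSobSq L 0 g = L ^ 3 * ∑' k, cnormSq (fc L g k) := by
      simp [homSobSq]
    rw [hU, Real.sq_sqrt, h0]
    rw [h0]
    exact mul_nonneg hL3.le (tsum_nonneg fun k => Finset.sum_nonneg fun i _ =>
      Complex.normSq_nonneg _)
  have hK2c : P ≤ K2c L α β A φ * (U + 1) := by
    have h1 : K ≤ K2c L α β A φ := by rw [hK]; exact le_max_right _ _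
    have h2 : K * √K * L2c L α A φ ≤ K2c L α β A φ := by
      have : K0c α β ^ ((3 : ℝ) / 2) = K * √K := by
        rw [← hK, show (3 : ℝ) / 2 = 1 + 1 / 2 by norm_num, Real.rpow_add (by linarith),
          Real.rpow_one, Real.sqrt_eq_rpow]
      rw [← this]; exact le_max_left _ _
    have h3 : P = K + K * √K * L2c L α A φ * U := by rw [hP, L2c]; ring
    rw [h3]
    nlinarith [mul_le_mul_of_nonneg_right h2 hU0]
  have hP0 : 0 ≤ P := by
    rw [hP]
    have : 0 ≤ K := by linarith
    positivity
  have hR : 0 ≤ K2c L α β A φ * (U + 1) := hP0.trans hK2c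
  apply Real.sqrt_le_iff.2
  refine ⟨?_, ?_⟩
  · have : 0 ≤ 3 * (K2c L α β A φ * (U + 1)) * U := by positivity
    linarith
  · calc sobSq L 2 v ≤ L ^ 3 * (8 * P ^ 2 * ∑' k, cnormSq (fc L g k)) :=
          mul_le_mul_of_nonneg_left hts hL3.le
      _ = 8 * P ^ 2 * U ^ 2 := by rw [hU2]; ring
      _ ≤ 9 * (K2c L α β A φ * (U + 1)) ^ 2 * U ^ 2 := by gcongr; norm_num
      _ = _ := by ring

/-- Proposition 4.3: `H²` regularity for the regularized nonlinear
filter equation, with constant `K₂ ≃ max(K₀^{3/2}L₂, K₀)`,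
`L₂ = α² ‖∇A‖_{L^∞} ‖φ‖_{H¹}` (the constant `C` is absolute). -/
theorem filter_equation_H2_regularity :
    ∃ C : ℝ, 0 < C ∧
      ∀ (L α β T : ℝ) (A : Vec → ℝ) (φ : Pt → ℝ) (u uα : ℝ → Pt → Vec),
        0 < L → 0 < α → 0 < β → β < 1 → 0 < T →
        IndicatorBounds β A → IndicatorC11 A →
        KernelH1 L φ →
        (∀ t ∈ Set.Icc (0 : ℝ) T, MemL2s L (u t)) →
        (∀ t ∈ Set.Icc (0 : ℝ) T, MemHs L 1 (uα t) ∧ DivFree L (uα t) ∧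
          FilterEq L α (fun x => A (pconv L φ (u t) x)) (uα t) (u t)) →
        ∀ t ∈ Set.Icc (0 : ℝ) T,
          sobSummable L 2 (uα t) ∧
          Real.sqrt (sobSq L 2 (uα t))
            ≤ C * K2c L α β A φ * (Real.sqrt (homSobSq L 0 (u t)) + 1) *
              Real.sqrt (homSobSq L 0 (u t)) := by
  refine ⟨3, by norm_num, ?_⟩
  intro L α β T A φ u uα hL hα hβ _ _ hA hA2 hφ hu hua t ht
  exact final_bound L α β A φ (u t) (uα t) hL hα hβ hA hA2 hφ (hu t ht) (hua t ht).1 (hua t ht).2.2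
end NSAlpha
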